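/- arXiv:2406.07452 — 3 statements merged into one kernel-verified Lean document; each statement's English description precedes it below -/
import Mathlib

section
/- Let K and L be compact Hausdorff spaces. Assume there exists a linear map T : C_p(K) → C_p(L) which is a homeomorphism onto its image and whose image is closed in C_p(L). If L is NY compact, then K is NY compact as well. -/
universe u

/-- The submodule of `X → ℝ` consisting of continuous functions. With the subspace
topology inherited from the product topology on `X → ℝ`, this is `C_p(X)`,
the space of continuous real functions with the topology of pointwise convergence. -/
def cpSubmodule (X : Type u) [TopologicalSpace X] : Submodule ℝ (X → ℝ) where
  carrier := {f | Continuous f}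
  add_mem' hf hg := hf.add hg
  zero_mem' := continuous_const
  smul_mem' := fun c {_} hf => hf.const_smul c

/-- `C_p(X)`: continuous real-valued functions on `X` with the pointwise convergence
topology (subspace of the product `X → ℝ`), as a topological real vector space. -/
abbrev Cp (X : Type u) [TopologicalSpace X] : Type u := ↥(cpSubmodule X)

/-- The zero point of the Hilbert cube `I^ω = [0,1]^ℕ`. -/
def hilbertZero : ℕ → Set.Icc (0 : ℝ) 1 :=
  fun _ => ⟨0, Set.left_mem_Icc.mpr zero_le_one⟩

/-- A space is NY compact if it is a compact Hausdorff space homeomorphic to a subspace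
of the σ-product `σ(I^ω, Γ) = {x ∈ (I^ω)^Γ : x γ = 0 for all but finitely many γ}` of
Hilbert cubes, for some index set `Γ`. -/
def IsNYCompact (K : Type u) [TopologicalSpace K] : Prop :=
  CompactSpace K ∧ T2Space K ∧
    ∃ (Γ : Type u) (f : K → Γ → ℕ → Set.Icc (0 : ℝ) 1),
      Topology.IsEmbedding f ∧ ∀ k, {γ | f k γ ≠ hilbertZero}.Finite

open Set Topology Cardinal

section ClosingOff

variable {Γ : Type u}

/-- `S` is closed under the set-valued finitary operation `c`. -/
def ClosedUnder (c : Finset Γ → Set Γ) (S : Set Γ) : Prop :=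
  ∀ G : Finset Γ, (G : Set Γ) ⊆ S → c G ⊆ S

/-- The least superset of `A` closed under `c`. -/
def closedHull (c : Finset Γ → Set Γ) (A : Set Γ) : Set Γ :=
  ⋂₀ {S | ClosedUnder c S ∧ A ⊆ S}

theorem closedUnder_univ (c : Finset Γ → Set Γ) : ClosedUnder c univ :=
  fun _ _ => subset_univ _

theorem closedUnder_closedHull (c : Finset Γ → Set Γ) (A : Set Γ) :
    ClosedUnder c (closedHull c A) :=
  fun G hG => subset_sInter fun _ hS => hS.1 G (hG.trans (sInter_subset_of_mem hS))

theorem subset_closedHull (c : Finset Γ → Set Γ) (A : Set Γ) : A ⊆ closedHull c A :=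
  subset_sInter fun _ hS => hS.2

theorem closedHull_subset {c : Finset Γ → Set Γ} {A S : Set Γ} (hS : ClosedUnder c S)
    (hA : A ⊆ S) : closedHull c A ⊆ S :=
  sInter_subset_of_mem ⟨hS, hA⟩

theorem closedHull_mono (c : Finset Γ → Set Γ) {A B : Set Γ} (h : A ⊆ B) :
    closedHull c A ⊆ closedHull c B :=
  closedHull_subset (closedUnder_closedHull c B) (h.trans (subset_closedHull c B))

theorem Monotone.directedOn_range_subset {J : Type*} [LinearOrder J] {S : J → Set Γ}
    (h : Monotone S) : DirectedOn (· ⊆ ·) (range S) := by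
  rintro _ ⟨i, rfl⟩ _ ⟨j, rfl⟩
  exact ⟨_, mem_range_self (max i j), h (le_max_left _ _), h (le_max_right _ _)⟩

theorem exists_mem_finset_subset_of_directedOn {𝒮 : Set (Set Γ)} (hne : 𝒮.Nonempty)
    (hdir : DirectedOn (· ⊆ ·) 𝒮) (G : Finset Γ) (hG : (G : Set Γ) ⊆ ⋃₀ 𝒮) :
    ∃ S ∈ 𝒮, (G : Set Γ) ⊆ S := by
  classical
  induction G using Finset.induction_on with
  | empty => obtain ⟨S, hS⟩ := hne; exact ⟨S, hS, by simp⟩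
  | insert a G _ ih =>
    rw [Finset.coe_insert, insert_subset_iff] at hG
    obtain ⟨S, hS, hGS⟩ := ih hG.2
    obtain ⟨S', hS', haS'⟩ := hG.1
    obtain ⟨S'', hS'', h1, h2⟩ := hdir S hS S' hS'
    refine ⟨S'', hS'', ?_⟩
    rw [Finset.coe_insert, insert_subset_iff]
    exact ⟨h2 haS', hGS.trans h1⟩

theorem closedUnder_sUnion {c : Finset Γ → Set Γ} {𝒮 : Set (Set Γ)} (hne : 𝒮.Nonempty)
    (hdir : DirectedOn (· ⊆ ·) 𝒮) (h : ∀ S ∈ 𝒮, ClosedUnder c S) : ClosedUnder c (⋃₀ 𝒮) := by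
  intro G hG
  obtain ⟨S, hS, hGS⟩ := exists_mem_finset_subset_of_directedOn hne hdir G hG
  exact (h S hS G hGS).trans (subset_sUnion_of_mem hS)

theorem mk_closedHull_le {c : Finset Γ → Set Γ} (hc : ∀ G, (c G).Countable) {κ : Cardinal.{u}}
    (hκ : ℵ₀ ≤ κ) {A : Set Γ} (hA : #A ≤ κ) : #(closedHull c A) ≤ κ := by
  let step : Set Γ → Set Γ := fun B => B ∪ ⋃ G : Finset B, c (G.map (Function.Embedding.subtype _))
  have hstep : ∀ B : Set Γ, #B ≤ κ → #(step B) ≤ κ := by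
    intro B hB
    refine (mk_union_le _ _).trans (add_le_of_le hκ hB ?_)
    refine (mk_iUnion_le _).trans (mul_le_of_le hκ ?_ ?_)
    · cases finite_or_infinite B
      · exact (mk_le_aleph0 (α := Finset B)).trans hκ
      · rw [mk_finset_of_infinite]; exact hB
    · exact ciSup_le' fun G => (mk_le_aleph0_iff.2 (hc _).to_subtype).trans hκ
  let it : ℕ → Set Γ := fun n => step^[n] A
  have hit : ∀ n, it (n + 1) = step (it n) := fun n => Function.iterate_succ_apply' step n A
  have hcard : ∀ n, #(it n) ≤ κ := by
    intro n
    induction n with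
    | zero => exact hA
    | succ n ih => rw [hit]; exact hstep _ ih
  have hmono : Monotone it := monotone_nat_of_le_succ fun n => by
    rw [hit]; exact subset_union_left
  have hdir : DirectedOn (· ⊆ ·) (range it) := hmono.directedOn_range_subset
  have hclosed : ClosedUnder c (⋃₀ range it) := by
    intro G hG
    obtain ⟨_, ⟨n, rfl⟩, hn⟩ := exists_mem_finset_subset_of_directedOn (range_nonempty it)
      hdir G hG
    classical
    refine subset_trans ?_ (subset_sUnion_of_mem (mem_range_self (n + 1)))
    rw [hit]
    refine subset_trans ?_ subset_union_right
    have : (G.subtype (· ∈ it n)).map (Function.Embedding.subtype _) = G :=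
      Finset.subtype_map_of_mem fun x hx => hn hx
    intro x hx
    exact mem_iUnion.2 ⟨G.subtype (· ∈ it n), by rw [this]; exact hx⟩
  refine (mk_le_mk_of_subset (closedHull_subset hclosed
    (subset_sUnion_of_mem (mem_range_self (f := it) 0)))).trans ?_
  rw [sUnion_range]
  have := mk_iUnion_le_lift it
  simp only [lift_uzero, mk_nat, lift_aleph0] at this
  refine (by simpa using this : #(⋃ i, it i) ≤ _).trans (mul_le_of_le hκ hκ (ciSup_le' hcard))

end ClosingOff

section Expansion

variable {K : Type u} [TopologicalSpace K]

/-- Countably many continuous real functions separate the points of `B`. -/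
def CountablySeparated (B : Set K) : Prop :=
  ∃ h : ℕ → C(K, ℝ), ∀ x ∈ B, ∀ y ∈ B, (∀ n, h n x = h n y) → x = y

theorem CountablySeparated.mono {A B : Set K} (hB : CountablySeparated B) (h : A ⊆ B) :
    CountablySeparated A :=
  let ⟨g, hg⟩ := hB
  ⟨g, fun x hx y hy => hg x (h hx) y (h hy)⟩

theorem CountablySeparated.secondCountableTopology {C : Set K} (hC : CountablySeparated C)
    (hcomp : IsCompact C) : SecondCountableTopology C := by
  obtain ⟨g, hg⟩ := hC
  have : CompactSpace C := isCompact_iff_compactSpace.1 hcomp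
  have hcont : Continuous fun (x : C) n => g n x := by fun_prop
  refine (hcont.isClosedEmbedding fun x y hxy => ?_).isEmbedding.secondCountableTopology
  exact Subtype.ext (hg x x.2 y y.2 fun n => congrFun hxy n)

theorem IsSigmaCompact.diff_of_countablySeparated [T2Space K] {B H : Set K}
    (hB : IsSigmaCompact B) (hsep : CountablySeparated B) (hH : IsClosed H) :
    IsSigmaCompact (B \ H) := by
  obtain ⟨C, hC, rfl⟩ := hB
  rw [iUnion_sdiff]
  refine isSigmaCompact_iUnion _ fun n => ?_
  have := (hsep.mono (subset_iUnion C n)).secondCountableTopology (hC n)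
  have : CompactSpace (C n) := isCompact_iff_compactSpace.1 (hC n)
  have hopen : IsOpen ((↑) ⁻¹' Hᶜ : Set (C n)) := hH.isOpen_compl.preimage continuous_subtype_val
  have := hopen.locallyCompactSpace
  have hσ : IsSigmaCompact ((↑) ⁻¹' Hᶜ : Set (C n)) :=
    isSigmaCompact_iff_sigmaCompactSpace.2 inferInstance
  have := hσ.image continuous_subtype_val
  rwa [Subtype.image_preimage_coe, ← sdiff_eq] at this

/-- `Z` is partitioned into σ-compact, countably separated pieces `B i` having a point-finite
open expansion `V i` which is `T₀` with respect to the partition. -/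
def HasPointFiniteExpansion (Z : Set K) : Prop :=
  ∃ (I : Type u) (B V : I → Set K), Z ⊆ ⋃ i, B i ∧ (∀ i, B i ⊆ Z) ∧
    (∀ i, IsOpen (V i) ∧ B i ⊆ V i ∧ IsSigmaCompact (B i) ∧ CountablySeparated (B i)) ∧
    (∀ x ∈ Z, {i | x ∈ V i}.Finite) ∧
    Pairwise fun i j => Disjoint (V i) (B j) ∨ Disjoint (V j) (B i)

theorem isNYCompact_of_hasPointFiniteExpansion [CompactSpace K] [T2Space K]
    (h : HasPointFiniteExpansion (univ : Set K)) : IsNYCompact K := by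
  obtain ⟨I, B, V, hcov, -, hBV, hfin, hT0⟩ := h
  choose hVo hBV hσ hsep using hBV
  choose C hC hCB using hσ
  choose g hg using hsep
  have hu : ∀ i k, ∃ u : C(K, ℝ), EqOn u 0 (V i)ᶜ ∧ EqOn u 1 (C i k) ∧ ∀ x, u x ∈ Icc 0 1 := by
    intro i k
    refine exists_continuous_zero_one_of_isClosed (hVo i).isClosed_compl (hC i k).isClosed ?_
    rw [disjoint_compl_left_iff_subset]
    exact ((subset_iUnion _ k).trans (hCB i).subset).trans (hBV i)
  choose u hu0 hu1 huI using hu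
  let w : I → ℕ → K → Icc (0 : ℝ) 1 := fun i k x => ⟨u i k x, huI i k x⟩
  have hw : ∀ i k, Continuous (w i k) := fun i k => (u i k).continuous.subtype_mk _
  let s : I → ℕ → K → Icc (0 : ℝ) 1 := fun i l x =>
    l.casesOn 1 fun l => unitInterval.sigmoid (g i l x)
  have hs : ∀ i l, Continuous (s i l) := by
    intro i l
    cases l with
    | zero => exact continuous_const
    | succ l => exact unitInterval.continuous_sigmoid.comp (g i l).continuous
  let f : K → I → ℕ → Icc (0 : ℝ) 1 := fun x i n => w i n.unpair.1 x * s i n.unpair.2 x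
  have hf : Continuous f :=
    continuous_pi fun i => continuous_pi fun n => (hw i _).mul (hs i _)
  have hfw : ∀ {x y}, f x = f y → ∀ i k, w i k x = w i k y := by
    intro x y hxy i k
    simpa [f, s] using congrFun (congrFun hxy i) (Nat.pair k 0)
  have hfs : ∀ {x y}, f x = f y → ∀ i k, w i k x = 1 → ∀ l, g i l x = g i l y := by
    intro x y hxy i k h1 l
    have h2 := hfw hxy i k
    have h3 := congrFun (congrFun hxy i) (Nat.pair k (l + 1))
    simp only [f, s, Nat.unpair_pair, ← h2, h1, one_mul] at h3
    exact unitInterval.sigmoid_injective h3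
  have hw1 : ∀ i x, x ∈ B i → ∃ k, w i k x = 1 := by
    intro i x hx
    rw [← hCB, mem_iUnion] at hx
    obtain ⟨k, hk⟩ := hx
    exact ⟨k, Subtype.ext (hu1 i k hk)⟩
  have hw0 : ∀ i k x, x ∉ V i → w i k x = 0 := fun i k x hx => Subtype.ext (hu0 i k hx)
  have hsepV : ∀ {x y}, f x = f y → ∀ i, x ∈ B i → y ∈ V i := by
    intro x y hxy i hx
    by_contra hy
    obtain ⟨k, hk⟩ := hw1 i x hx
    have := hfw hxy i k
    rw [hk, hw0 i k y hy] at this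
    exact one_ne_zero this
  have hinj : Function.Injective f := by
    intro x y hxy
    obtain ⟨i, hi⟩ := mem_iUnion.1 (hcov (mem_univ x))
    obtain ⟨j, hj⟩ := mem_iUnion.1 (hcov (mem_univ y))
    by_cases hij : i = j
    · subst hij
      obtain ⟨k, hk⟩ := hw1 i x hi
      exact hg i x hi y hj (hfs hxy i k hk)
    · rcases hT0 hij with h | h
      · exact (disjoint_left.1 h (hsepV hxy i hi) hj).elim
      · exact (disjoint_left.1 h (hsepV hxy.symm j hj) hi).elim
  refine ⟨inferInstance, inferInstance, I, f, (hf.isClosedEmbedding hinj).isEmbedding, fun x => ?_⟩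
  refine (hfin x (mem_univ x)).subset fun i hi => ?_
  by_contra hx
  refine hi (funext fun n => ?_)
  change w i _ x * _ = _
  rw [hw0 i _ x hx, zero_mul]
  rfl

end Expansion

section RetractionSystem

/-- A commuting system of retractions of `K` indexed by the subsets of `Γ` closed under a finitary
operation with countable values; retractions indexed by countable sets have countably separated
ranges, and the fixed-point sets are continuous along directed unions. -/
structure RetractionSystem (K : Type u) [TopologicalSpace K] (Γ : Type u) where
  /-- the finitary operation -/
  c : Finset Γ → Set Γ
  countable_c : ∀ G, (c G).Countable
  /-- the retractions -/
  ρ : Set Γ → K → K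
  continuous_ρ : ∀ {S}, ClosedUnder c S → Continuous (ρ S)
  ρ_ρ_of_subset : ∀ {S S'}, ClosedUnder c S → ClosedUnder c S' → S ⊆ S' → ∀ x,
    ρ S (ρ S' x) = ρ S x
  ρ_ρ_of_superset : ∀ {S S'}, ClosedUnder c S → ClosedUnder c S' → S ⊆ S' → ∀ x,
    ρ S' (ρ S x) = ρ S x
  exists_of_sUnion : ∀ {𝒮 : Set (Set Γ)}, 𝒮.Nonempty → DirectedOn (· ⊆ ·) 𝒮 →
    (∀ S ∈ 𝒮, ClosedUnder c S) → ∀ x, ρ (⋃₀ 𝒮) x = x → ∃ S ∈ 𝒮, ρ S x = x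
  countablySeparated : ∀ {S}, ClosedUnder c S → S.Countable → CountablySeparated {x | ρ S x = x}
  ρ_univ : ∀ x, ρ univ x = x

namespace RetractionSystem

variable {K : Type u} [TopologicalSpace K] {Γ : Type u}

/-- The range of the retraction indexed by `S`. -/
def fixed (R : RetractionSystem K Γ) (S : Set Γ) : Set K := {x | R.ρ S x = x}

variable (R : RetractionSystem K Γ)

theorem ρ_mem_fixed {S : Set Γ} (hS : ClosedUnder R.c S) (x : K) : R.ρ S x ∈ R.fixed S :=
  R.ρ_ρ_of_subset hS hS subset_rfl x

theorem fixed_mono {S S' : Set Γ} (hS : ClosedUnder R.c S) (hS' : ClosedUnder R.c S')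
    (h : S ⊆ S') : R.fixed S ⊆ R.fixed S' := by
  intro x (hx : R.ρ S x = x)
  change R.ρ S' x = x
  rw [← hx, R.ρ_ρ_of_superset hS hS' h]

theorem isClosed_fixed [T2Space K] {S : Set Γ} (hS : ClosedUnder R.c S) :
    IsClosed (R.fixed S) :=
  isClosed_eq (R.continuous_ρ hS) continuous_id

theorem finite_setOf_ρ_notMem {J : Type u} [LinearOrder J] [WellFoundedLT J] {S : J → Set Γ}
    (hmono : Monotone S) (hS : ∀ j, ClosedUnder R.c (S j)) (x : K) :
    {j | R.ρ (S j) x ∉ ⋃ i < j, R.fixed (S i)}.Finite := by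
  by_contra hinf
  let e := Set.Infinite.natEmbedding _ hinf
  obtain ⟨g, hg⟩ := exists_increasing_or_nonincreasing_subseq (· < ·) fun n => (e n : J)
  have hlt : StrictMono fun n => (e (g n) : J) := by
    rcases hg with hg | hg
    · exact fun m n hmn => hg m n hmn
    · exfalso
      have hanti : StrictAnti fun n => (e (g n) : J) := by
        intro m n hmn
        refine lt_of_le_of_ne (not_lt.1 (hg m n hmn)) fun h => ?_
        exact hmn.ne' (g.injective (e.injective (Subtype.ext h)))
      exact not_strictAnti_of_wellFoundedLT _ hanti
  set a : ℕ → J := fun n => (e (g n) : J) with ha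
  let 𝒮 : Set (Set Γ) := range fun n => S (a n)
  have hdir : DirectedOn (· ⊆ ·) 𝒮 :=
    (hmono.comp hlt.monotone).directedOn_range_subset
  have hclosed : ∀ T ∈ 𝒮, ClosedUnder R.c T := forall_mem_range.2 fun n => hS _
  have hU := closedUnder_sUnion (range_nonempty _) hdir hclosed
  obtain ⟨_, ⟨n, rfl⟩, hn⟩ := R.exists_of_sUnion (range_nonempty _) hdir hclosed _
    (R.ρ_mem_fixed hU x)
  have hnm : a n < a (n + 1) := hlt n.lt_succ_self
  refine (e (g (n + 1))).2 (mem_biUnion hnm ?_)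
  change R.ρ (S (a (n + 1))) x ∈ _
  rw [← R.ρ_ρ_of_subset (hS _) hU (subset_sUnion_of_mem (mem_range_self (n + 1)))]
  have h1 : R.ρ (⋃₀ 𝒮) x ∈ R.fixed (S (a n)) := hn
  have h2 := R.fixed_mono (hS _) (hS _) (hmono hnm.le) h1
  rw [show R.ρ (S (a (n + 1))) (R.ρ (⋃₀ 𝒮) x) = _ from h2]
  exact h1

theorem hasPointFiniteExpansion_of_countable [CompactSpace K] [T2Space K] {S : Set Γ}
    (hS : ClosedUnder R.c S) (hcount : S.Countable) : HasPointFiniteExpansion (R.fixed S) :=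
  ⟨PUnit, fun _ => R.fixed S, fun _ => univ, subset_iUnion (fun _ : PUnit => R.fixed S) ⟨⟩,
    fun _ => subset_rfl, fun _ => ⟨isOpen_univ, subset_univ _,
      (R.isClosed_fixed hS).isCompact.isSigmaCompact, R.countablySeparated hS hcount⟩,
    fun _ _ => toFinite _, fun _ _ h => (h rfl).elim⟩

theorem hasPointFiniteExpansion_of_monotone [T2Space K] {J : Type u}
    [LinearOrder J] [WellFoundedLT J] {S : J → Set Γ} {U : Set Γ} (hU : ClosedUnder R.c U)
    (hmono : Monotone S) (hS : ∀ j, ClosedUnder R.c (S j)) (hSU : ∀ j, S j ⊆ U)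
    (hcov : R.fixed U ⊆ ⋃ j, R.fixed (S j))
    (h : ∀ j, HasPointFiniteExpansion (R.fixed (S j))) : HasPointFiniteExpansion (R.fixed U) := by
  choose I B V hB hBS hBV hfin hT0 using h
  let N : J → Set K := fun j => ⋃ i < j, R.fixed (S i)
  have hN : ∀ j, IsClosed (N j) := by
    intro j
    by_cases hj : (Iio j).Nonempty
    · let 𝒮 : Set (Set Γ) := S '' Iio j
      have hdir : DirectedOn (· ⊆ ·) 𝒮 := by
        rintro _ ⟨i, hi, rfl⟩ _ ⟨i', hi', rfl⟩
        exact ⟨S (max i i'), mem_image_of_mem _ (max_lt hi hi'), hmono (le_max_left _ _),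
          hmono (le_max_right _ _)⟩
      have hclosed : ∀ T ∈ 𝒮, ClosedUnder R.c T := forall_mem_image.2 fun i _ => hS i
      have hU := closedUnder_sUnion (hj.image _) hdir hclosed
      have : N j = R.fixed (⋃₀ 𝒮) := by
        refine subset_antisymm (iUnion₂_subset fun i hi => ?_) fun x hx => ?_
        · exact R.fixed_mono (hS i) hU (subset_sUnion_of_mem (mem_image_of_mem _ hi))
        · obtain ⟨_, ⟨i, hi, rfl⟩, hx⟩ := R.exists_of_sUnion (hj.image _) hdir hclosed x hx
          exact mem_biUnion hi hx
      rw [this]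
      exact R.isClosed_fixed hU
    · have : N j = ∅ := by
        simp only [N, iUnion_eq_empty]
        exact fun i hi => (hj ⟨i, hi⟩).elim
      rw [this]
      exact isClosed_empty
  refine ⟨Σ j, I j, fun p => B p.1 p.2 \ N p.1, fun p => R.ρ (S p.1) ⁻¹' (V p.1 p.2 \ N p.1),
    ?_, ?_, ?_, ?_, ?_⟩
  · intro x hx
    have hne : {j | x ∈ R.fixed (S j)}.Nonempty := mem_iUnion.1 (hcov hx)
    obtain ⟨j, hj, hmin⟩ := wellFounded_lt.has_min _ hne
    obtain ⟨i, hi⟩ := mem_iUnion.1 (hB j hj)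
    refine mem_iUnion.2 ⟨⟨j, i⟩, hi, fun hN => ?_⟩
    obtain ⟨i', hi', hx'⟩ := mem_iUnion₂.1 hN
    exact hmin _ hx' hi'
  · exact fun p => sdiff_subset.trans ((hBS _ _).trans (R.fixed_mono (hS _) hU (hSU _)))
  · intro p
    obtain ⟨h1, h2, h3, h4⟩ := hBV p.1 p.2
    refine ⟨(h1.sdiff (hN _)).preimage (R.continuous_ρ (hS _)), fun x hx => ?_,
      h3.diff_of_countablySeparated h4 (hN _), h4.mono sdiff_subset⟩
    have hx' : R.ρ (S p.1) x = x := hBS _ _ hx.1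
    rw [mem_preimage, hx']
    exact ⟨h2 hx.1, hx.2⟩
  · intro x _
    have h1 := R.finite_setOf_ρ_notMem hmono hS x
    have h2 : ∀ j, {i | R.ρ (S j) x ∈ V j i}.Finite := fun j => hfin j _ (R.ρ_mem_fixed (hS j) x)
    refine (h1.biUnion fun j _ => (h2 j).image (Sigma.mk j)).subset fun p hp => ?_
    exact mem_biUnion hp.2 ⟨p.2, hp.1, rfl⟩
  · have key : ∀ p q : Σ j, I j, p.1 < q.1 →
        Disjoint (R.ρ (S q.1) ⁻¹' (V q.1 q.2 \ N q.1)) (B p.1 p.2 \ N p.1) := by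
      intro p q hpq
      refine disjoint_left.2 fun x hx hx' => hx.2 ?_
      have h1 := hBS _ _ hx'.1
      have h2 : R.ρ (S q.1) x = x := R.fixed_mono (hS _) (hS _) (hmono hpq.le) h1
      rw [h2]
      exact mem_biUnion hpq h1
    rintro ⟨j, i⟩ ⟨j', i'⟩ hne
    rcases lt_trichotomy j j' with hlt | rfl | hlt
    · exact Or.inr (key ⟨j, i⟩ ⟨j', i'⟩ hlt)
    · have hii : i ≠ i' := fun h => hne (by rw [h])
      have key' : ∀ k k', Disjoint (V j k) (B j k') →
          Disjoint (R.ρ (S j) ⁻¹' (V j k \ N j)) (B j k' \ N j) := by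
        intro k k' hd
        refine disjoint_left.2 fun x hx hx' => ?_
        have h1 : R.ρ (S j) x = x := hBS _ _ hx'.1
        rw [mem_preimage, h1] at hx
        exact disjoint_left.1 hd hx.1 hx'.1
      exact (hT0 j hii).imp (key' _ _) (key' _ _)
    · exact Or.inl (key ⟨j', i'⟩ ⟨j, i⟩ hlt)

theorem hasPointFiniteExpansion [CompactSpace K] [T2Space K] (κ : Cardinal.{u}) :
    ∀ S : Set Γ, ClosedUnder R.c S → #S = κ → HasPointFiniteExpansion (R.fixed S) := by
  induction κ using WellFoundedLT.induction with
  | ind κ ih =>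
    intro S hS hκ
    rcases le_or_gt κ ℵ₀ with hle | hlt
    · exact R.hasPointFiniteExpansion_of_countable hS (le_aleph0_iff_set_countable.1 (hκ ▸ hle))
    · obtain ⟨_, _, hord⟩ := exists_ord_eq_type_lt S
      let T : S → Set Γ := fun j => closedHull R.c ((↑) '' Iic j)
      have hT : ∀ j, ClosedUnder R.c (T j) := fun j => closedUnder_closedHull _ _
      have hmono : Monotone T := fun i j hij =>
        closedHull_mono _ (image_mono (Iic_subset_Iic.2 hij))
      have hTS : ∀ j, T j ⊆ S := fun j =>
        closedHull_subset hS (by rintro _ ⟨s, -, rfl⟩; exact s.2)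
      have hinf : ℵ₀ ≤ #S := hκ ▸ hlt.le
      have hcard : ∀ j, #(T j) < κ := by
        intro j
        have h1 : #((↑) '' Iic j : Set Γ) < κ := mk_image_le.trans_lt
          (hκ ▸ mk_Iic_lt j hord hinf)
        refine (mk_closedHull_le R.countable_c (le_max_right _ ℵ₀) (le_max_left _ _)).trans_lt
          (max_lt h1 hlt)
      have hne : Nonempty S := mk_ne_zero_iff.1 (aleph0_pos.trans_le hinf).ne'
      have hunion : ⋃₀ range T = S := by
        refine subset_antisymm (sUnion_subset (forall_mem_range.2 hTS)) fun s hs => ?_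
        exact ⟨T ⟨s, hs⟩, mem_range_self _, subset_closedHull _ _ ⟨⟨s, hs⟩, mem_Iic.2 le_rfl, rfl⟩⟩
      refine R.hasPointFiniteExpansion_of_monotone hS hmono hT hTS ?_
        fun j => ih _ (hcard j) _ (hT j) rfl
      intro x hx
      rw [← hunion] at hx
      obtain ⟨_, ⟨j, rfl⟩, hj⟩ := R.exists_of_sUnion (range_nonempty T)
        hmono.directedOn_range_subset (forall_mem_range.2 hT) x hx
      exact mem_iUnion.2 ⟨j, hj⟩

theorem isNYCompact [CompactSpace K] [T2Space K] (R : RetractionSystem K Γ) : IsNYCompact K := by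
  refine isNYCompact_of_hasPointFiniteExpansion ?_
  have : R.fixed Set.univ = Set.univ := eq_univ_of_forall R.ρ_univ
  rw [← this]
  exact R.hasPointFiniteExpansion _ _ (closedUnder_univ _) rfl

end RetractionSystem

end RetractionSystem

section Truncation

theorem exists_countable_subset_image_subset_closure {α β : Type*} [TopologicalSpace β]
    [SecondCountableTopology β] (f : α → β) (s : Set α) :
    ∃ t ⊆ s, t.Countable ∧ f '' s ⊆ closure (f '' t) := by
  obtain ⟨D, hD, hdense⟩ := TopologicalSpace.exists_countable_dense (f '' s)
  choose g hgs hg using fun d : f '' s => d.2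
  refine ⟨g '' D, image_subset_iff.2 fun d _ => hgs d, hD.image g, ?_⟩
  rw [image_image]
  simp only [hg]
  exact Subtype.dense_iff.1 hdense

variable {Γ : Type u} {X : Type*}

open Classical in
/-- Replace the coordinates of `a` outside `S` by `o`. -/
noncomputable def truncate (o : X) (S : Set Γ) (a : Γ → X) : Γ → X :=
  fun γ => if γ ∈ S then a γ else o

theorem truncate_of_mem (o : X) {S : Set Γ} (a : Γ → X) {γ : Γ} (h : γ ∈ S) :
    truncate o S a γ = a γ :=
  if_pos h

theorem truncate_of_notMem (o : X) {S : Set Γ} (a : Γ → X) {γ : Γ} (h : γ ∉ S) :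
    truncate o S a γ = o :=
  if_neg h

theorem truncate_eq_self {o : X} {S : Set Γ} {a : Γ → X} (h : {γ | a γ ≠ o} ⊆ S) :
    truncate o S a = a := by
  funext γ
  by_cases hγ : γ ∈ S
  · exact truncate_of_mem o a hγ
  · rw [truncate_of_notMem o a hγ]
    by_contra hne
    exact hγ (h (Ne.symm hne))

theorem setOf_truncate_ne_subset (o : X) (S : Set Γ) (a : Γ → X) :
    {γ | truncate o S a γ ≠ o} ⊆ S := by
  intro γ hγ
  by_contra h
  exact hγ (truncate_of_notMem o a h)

theorem truncate_truncate (o : X) (S S' : Set Γ) (a : Γ → X) :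
    truncate o S (truncate o S' a) = truncate o (S ∩ S') a := by
  funext γ
  by_cases h : γ ∈ S <;> by_cases h' : γ ∈ S' <;> simp [truncate, h, h']

theorem continuous_truncate [TopologicalSpace X] (o : X) (S : Set Γ) :
    Continuous (truncate o S) := by
  refine continuous_pi fun γ => ?_
  by_cases h : γ ∈ S
  · simpa only [truncate_of_mem o _ h] using continuous_apply γ
  · simpa only [truncate_of_notMem o _ h] using continuous_const

theorem exists_closedUnder_truncate {L : Type*} [TopologicalSpace L] [CompactSpace L]
    [TopologicalSpace X] [T2Space X] [SecondCountableTopology X] {o : X} {e : L → Γ → X}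
    (he : Continuous e) (hfin : ∀ y, {γ | e y γ ≠ o}.Finite) {ι : Type*} [Countable ι]
    (n : ι → ℕ) (A : ∀ k, Set ((Fin (n k) → ℝ) × (Fin (n k) → L))) (hA : ∀ k, IsClosed (A k)) :
    ∃ c : Finset Γ → Set Γ, (∀ G, (c G).Countable) ∧ ∀ S, ClosedUnder c S → ∀ k, ∀ p ∈ A k,
      ∃ z, (p.1, z) ∈ A k ∧ ∀ i, e (z i) = truncate o S (e (p.2 i)) := by
  classical
  let π : ∀ k (G : Finset Γ), (Fin (n k) → ℝ) × (Fin (n k) → L) →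
      (Fin (n k) → ℝ) × (Fin (n k) → G → X) := fun k G p => (p.1, fun i γ => e (p.2 i) γ)
  choose Λ hΛA hΛ hΛd using fun k G => exists_countable_subset_image_subset_closure (π k G) (A k)
  refine ⟨fun G => ⋃ k, ⋃ p ∈ Λ k G, ⋃ i, {γ | e (p.2 i) γ ≠ o}, fun G => ?_, ?_⟩
  · exact countable_iUnion fun k => (hΛ k G).biUnion fun p _ =>
      countable_iUnion fun i => (hfin _).countable
  intro S hS k p hp
  let Ψ : (Fin (n k) → ℝ) × (Fin (n k) → L) → (Fin (n k) → ℝ) × (Fin (n k) → Γ → X) :=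
    Prod.map id fun y i => e (y i)
  have hcont : Continuous fun (y : Fin (n k) → L) i => e (y i) := by fun_prop
  have hΨ : IsClosedMap Ψ := (isProperMap_id.prodMap hcont.isProperMap).isClosedMap
  suffices h : (p.1, fun i => truncate o S (e (p.2 i))) ∈ Ψ '' A k by
    obtain ⟨q, hq, hqp⟩ := h
    obtain ⟨h1, h2⟩ := Prod.ext_iff.1 hqp
    exact ⟨q.2, (show q = (p.1, q.2) from Prod.ext h1 rfl) ▸ hq, fun i => congrFun h2 i⟩
  rw [← (hΨ _ (hA k)).closure_eq, mem_closure_iff]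
  intro O hO hmem
  obtain ⟨u, v, hu, hv, hpu, hpv, huv⟩ := isOpen_prod_iff.1 hO _ _ hmem
  obtain ⟨w, hw, hwv⟩ := isOpen_pi_iff'.1 hv _ hpv
  choose F W hW hWw using fun i => isOpen_pi_iff.1 (hw i).1 _ (hw i).2
  let G : Finset Γ := (Finset.univ.biUnion F).filter (· ∈ S)
  have hGS : (G : Set Γ) ⊆ S := fun γ hγ => (Finset.mem_filter.1 hγ).2
  have hev : ∀ᶠ q in 𝓝 (π k G p), q.1 ∈ u ∧ ∀ i, ∀ γ : G, (γ : Γ) ∈ F i → q.2 i γ ∈ W i γ := by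
    have hfst : ∀ᶠ q in 𝓝 (π k G p), q.1 ∈ u :=
      continuous_fst.continuousAt.eventually_mem (hu.mem_nhds hpu)
    refine hfst.and ?_
    refine Filter.eventually_all.2 fun i => Filter.eventually_all.2 fun γ => ?_
    refine Filter.eventually_imp_distrib_left.2 fun hγ => ?_
    have hc : Continuous fun q : (Fin (n k) → ℝ) × (Fin (n k) → G → X) => q.2 i γ := by fun_prop
    refine hc.continuousAt.eventually_mem ((hW i γ hγ).1.mem_nhds ?_)
    have := (hW i γ hγ).2
    rwa [truncate_of_mem o _ (hGS γ.2)] at this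
  obtain ⟨_, ⟨q, hq, rfl⟩, hqu, hqW⟩ :=
    ((mem_closure_iff_frequently.1 (hΛd k G (mem_image_of_mem _ hp))).and_eventually hev).exists
  refine ⟨Ψ q, huv ⟨hqu, hwv fun i _ => hWw i fun γ hγ => ?_⟩, mem_image_of_mem _ (hΛA k G hq)⟩
  by_cases hγS : γ ∈ S
  · exact hqW i ⟨γ, Finset.mem_filter.2
      ⟨Finset.mem_biUnion.2 ⟨i, Finset.mem_univ i, hγ⟩, hγS⟩⟩ hγ
  · have h1 := (hW i γ hγ).2
    rw [truncate_of_notMem o _ hγS] at h1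
    have h2 : e (q.2 i) γ = o := by
      by_contra hne
      exact hγS (hS G hGS (mem_iUnion.2 ⟨k, mem_iUnion₂.2 ⟨q, hq, mem_iUnion.2 ⟨i, hne⟩⟩⟩))
    change e (q.2 i) γ ∈ W i γ
    rwa [h2]

end Truncation

section Representation

variable {K L : Type u} [TopologicalSpace K] [TopologicalSpace L]

theorem eq_of_forall_cp_eq [CompactSpace K] [T2Space K] {x y : K}
    (h : ∀ f : Cp K, f.1 x = f.1 y) : x = y := by
  by_contra hne
  obtain ⟨f, h0, h1, -⟩ := exists_continuous_zero_one_of_isClosed (isClosed_singleton (x := x))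
    (isClosed_singleton (x := y)) (disjoint_singleton.2 hne)
  have := h ⟨f, f.continuous⟩
  exact zero_ne_one ((h0 rfl).symm.trans (Eq.trans this (h1 rfl)))

theorem continuous_of_forall_cp_comp [CompactSpace K] [T2Space K] {Y : Type*} [TopologicalSpace Y]
    {g : Y → K} (h : ∀ f : Cp K, Continuous fun y => f.1 (g y)) : Continuous g := by
  have hcont : Continuous fun (x : K) (f : Cp K) => f.1 x := continuous_pi fun f => f.2
  have hemb := hcont.isClosedEmbedding fun x y hxy => eq_of_forall_cp_eq (congrFun hxy)
  exact hemb.isInducing.continuous_iff.2 (continuous_pi h)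

/-- The evaluation at `x`, transported along `T`, is the combination of the evaluations
at the points `y i` with coefficients `a i`. -/
def Represents (T : Cp K →ₗ[ℝ] Cp L) (x : K) {n : ℕ} (a : Fin n → ℝ) (y : Fin n → L) : Prop :=
  ∀ f : Cp K, f.1 x = ∑ i, a i * (T f).1 (y i)

variable {T : Cp K →ₗ[ℝ] Cp L}

theorem Represents.eq [CompactSpace K] [T2Space K] {x x' : K} {n : ℕ} {a : Fin n → ℝ}
    {y : Fin n → L} (h : Represents T x a y) (h' : Represents T x' a y) : x = x' :=
  eq_of_forall_cp_eq fun f => (h f).trans (h' f).symm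

theorem exists_represents (hT : IsInducing T) (x : K) :
    ∃ (n : ℕ) (a : Fin n → ℝ) (y : Fin n → L), Represents T x a y := by
  let ev : Cp K →ₗ[ℝ] ℝ := (LinearMap.proj x).comp (cpSubmodule K).subtype
  have hev : Continuous ev := (continuous_apply x).comp continuous_subtype_val
  have hO : IsOpen {f : Cp K | |ev f| < 1} := isOpen_lt (by fun_prop) continuous_const
  obtain ⟨V, hV, hVO⟩ := (IsInducing.subtypeVal.comp hT).isOpen_iff.1 hO
  have h0 : (0 : L → ℝ) ∈ V := by
    have : (0 : Cp K) ∈ {f : Cp K | |ev f| < 1} := by simp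
    rw [← hVO] at this
    simpa using this
  obtain ⟨F, W, hW, hWV⟩ := isOpen_pi_iff.1 hV 0 h0
  let y : Fin F.card → L := fun i => F.equivFin.symm i
  let φ : Fin F.card → Cp K →ₗ[ℝ] ℝ := fun i =>
    ((LinearMap.proj (y i)).comp (cpSubmodule L).subtype).comp T
  have hker : ∀ f : Cp K, (∀ i, φ i f = 0) → |ev f| < 1 := by
    intro f hf
    change f ∈ {f : Cp K | |ev f| < 1}
    rw [← hVO]
    refine hWV fun z hz => ?_
    have : (T f).1 z = 0 := by simpa [φ, y] using hf (F.equivFin ⟨z, hz⟩)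
    change (T f).1 z ∈ W z
    rw [this]
    exact (hW z hz).2
  have hspan : ev ∈ Submodule.span ℝ (range φ) := by
    refine mem_span_of_iInf_ker_le_ker fun f hf => ?_
    simp only [Submodule.mem_iInf, LinearMap.mem_ker] at hf ⊢
    by_contra hne
    have := hker ((ev f)⁻¹ • f) fun i => by rw [map_smul, hf, smul_zero]
    rw [map_smul, smul_eq_mul, inv_mul_cancel₀ hne, abs_one] at this
    exact lt_irrefl _ this
  obtain ⟨a, ha⟩ := (Submodule.mem_span_range_iff_exists_fun ℝ).1 hspan
  refine ⟨F.card, a, y, fun f => ?_⟩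
  have := congrArg (fun ψ : Cp K →ₗ[ℝ] ℝ => ψ f) ha
  simpa [ev, φ] using this.symm

theorem isClosed_ofPred_exists_represents [CompactSpace K] (n : ℕ) :
    IsClosed {p : (Fin n → ℝ) × (Fin n → L) | ∃ x, Represents T x p.1 p.2} := by
  have h : IsClosed {q : K × ((Fin n → ℝ) × (Fin n → L)) | Represents T q.1 q.2.1 q.2.2} := by
    simp only [Represents, ofPred_forall]
    refine isClosed_iInter fun f => isClosed_eq (f.2.comp continuous_fst) ?_
    refine continuous_finsetSum _ fun i _ => Continuous.mul (by fun_prop) ?_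
    exact (T f).2.comp (by fun_prop)
  convert isClosedMap_snd_of_compactSpace _ h using 1
  ext p
  simp

theorem exists_retractions [CompactSpace K] [T2Space K] [CompactSpace L] {Γ : Type u}
    {X : Type*} [TopologicalSpace X] [T2Space X] [SecondCountableTopology X] (hT : IsInducing T)
    (hTc : IsClosed (range T)) {o : X} {e : L → Γ → X} (he : IsEmbedding e)
    (hfin : ∀ y, {γ | e y γ ≠ o}.Finite) :
    ∃ (c : Finset Γ → Set Γ) (r : Set Γ → L → L) (ρ : Set Γ → K → K), (∀ G, (c G).Countable) ∧
      ∀ S, ClosedUnder c S → (∀ y, e (r S y) = truncate o S (e y)) ∧ Continuous (r S) ∧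
        Continuous (ρ S) ∧ ∀ (x : K) (n : ℕ) (a : Fin n → ℝ) (y : Fin n → L),
          Represents T x a y → Represents T (ρ S x) a fun i => r S (y i) := by
  obtain ⟨c₁, hc₁, h₁⟩ := exists_closedUnder_truncate he.continuous hfin (fun _ : Unit => 1)
    (fun _ => univ) fun _ => isClosed_univ
  obtain ⟨c₂, hc₂, h₂⟩ := exists_closedUnder_truncate he.continuous hfin (fun k : ℕ × ℕ => k.1)
    (fun k => {p | ∀ f : Cp K, ∃ i, 1 / ((k.2 : ℝ) + 1) ≤ |(T f).1 (p.2 i) - p.1 i|}) (by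
      intro k
      simp only [ofPred_forall, ofPred_exists]
      refine isClosed_iInter fun f => isClosed_iUnion_of_finite fun i => ?_
      refine isClosed_le continuous_const (Continuous.abs (Continuous.sub ?_ (by fun_prop)))
      exact (T f).2.comp (by fun_prop))
  obtain ⟨c₃, hc₃, h₃⟩ := exists_closedUnder_truncate he.continuous hfin (fun n : ℕ => n)
    (fun n => {p | ∃ x, Represents T x p.1 p.2}) isClosed_ofPred_exists_represents
  let c : Finset Γ → Set Γ := fun G => c₁ G ∪ c₂ G ∪ c₃ G
  suffices h : ∀ S, ClosedUnder c S → ∃ (r : L → L) (ρ : K → K),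
      (∀ y, e (r y) = truncate o S (e y)) ∧ Continuous r ∧
        Continuous ρ ∧ ∀ (x : K) (n : ℕ) (a : Fin n → ℝ) (y : Fin n → L),
          Represents T x a y → Represents T (ρ x) a fun i => r (y i) by
    have : Nonempty (L → L) := ⟨id⟩
    have : Nonempty (K → K) := ⟨id⟩
    choose! r ρ hrρ using h
    exact ⟨c, r, ρ, fun G => ((hc₁ G).union (hc₂ G)).union (hc₃ G), hrρ⟩
  intro S hS
  have hS₁ : ClosedUnder c₁ S := fun G hG =>
    (subset_union_left.trans subset_union_left).trans (hS G hG)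
  have hS₂ : ClosedUnder c₂ S := fun G hG =>
    (subset_union_right.trans subset_union_left).trans (hS G hG)
  have hS₃ : ClosedUnder c₃ S := fun G hG => subset_union_right.trans (hS G hG)
  have hr : ∀ y, ∃ y', e y' = truncate o S (e y) := fun y =>
    let ⟨z, _, hz⟩ := h₁ S hS₁ () (0, fun _ => y) (mem_univ _)
    ⟨z 0, hz 0⟩
  choose r hr using hr
  have hrc : Continuous r := by
    rw [he.continuous_iff]
    simpa only [Function.comp_def, hr] using (continuous_truncate o S).comp he.continuous
  have hP : ∀ f : Cp K, ∃ f' : Cp K, ∀ y, (T f').1 y = (T f).1 (r y) := by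
    intro f
    let g : Cp L := ⟨fun y => (T f).1 (r y), (T f).2.comp hrc⟩
    suffices hg : g ∈ range T by
      obtain ⟨f', hf'⟩ := hg
      exact ⟨f', fun y => by rw [hf']⟩
    by_contra hg
    obtain ⟨O, hO, hOT⟩ := IsInducing.subtypeVal.isOpen_iff.1 hTc.isOpen_compl
    have hgO : g ∈ Subtype.val ⁻¹' O := hOT ▸ hg
    obtain ⟨F, W, hW, hWO⟩ := isOpen_pi_iff.1 hO _ hgO
    have hm : ∀ᶠ m : ℕ in Filter.atTop, ∀ y ∈ F, ∀ t : ℝ,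
        |t - g.1 y| < 1 / ((m : ℝ) + 1) → t ∈ W y := by
      refine (Filter.eventually_all_finset F).2 fun y hy => ?_
      obtain ⟨ε, hε, hεW⟩ := Metric.isOpen_iff.1 (hW y hy).1 _ (hW y hy).2
      filter_upwards [tendsto_one_div_add_atTop_nhds_zero_nat.eventually_lt_const hε]
        with m hm t ht
      exact hεW (ht.trans hm)
    obtain ⟨m, hm⟩ := hm.exists
    let y : Fin F.card → L := fun i => F.equivFin.symm i
    obtain ⟨z, hz, hzr⟩ := h₂ S hS₂ (F.card, m) (fun i => g.1 (y i), y) (by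
      intro f'
      by_contra! hlt
      have : T f' ∈ (range T)ᶜ := by
        rw [← hOT]
        refine hWO fun w hw => hm w hw _ ?_
        simpa [y] using hlt (F.equivFin ⟨w, hw⟩)
      exact this (mem_range_self f'))
    obtain ⟨i, hi⟩ := hz f
    have hzi : z i = r (y i) := he.injective ((hzr i).trans (hr _).symm)
    simp only [hzi, show g.1 (y i) = (T f).1 (r (y i)) from rfl, sub_self, abs_zero] at hi
    exact hi.not_gt (by positivity)
  choose P hP using hP
  have hPx : ∀ (f : Cp K) (x : K) (n : ℕ) (a : Fin n → ℝ) (y : Fin n → L), Represents T x a y →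
      (P f).1 x = ∑ i, a i * (T f).1 (r (y i)) := fun f x n a y h => by
    simpa only [hP] using h (P f)
  have hρ : ∀ x, ∃ x', ∀ f : Cp K, f.1 x' = (P f).1 x := by
    intro x
    obtain ⟨n, a, y, h⟩ := exists_represents hT x
    obtain ⟨z, ⟨x', hx'⟩, hz⟩ := h₃ S hS₃ n (a, y) ⟨x, h⟩
    refine ⟨x', fun f => ?_⟩
    rw [hPx f x n a y h, hx' f]
    simp only [show ∀ i, z i = r (y i) from fun i => he.injective ((hz i).trans (hr _).symm)]
  choose ρ hρ using hρ
  refine ⟨r, ρ, hr, hrc, continuous_of_forall_cp_comp fun f => ?_, fun x n a y h f => ?_⟩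
  · simp only [hρ]
    exact (P f).2
  · rw [hρ, hPx f x n a y h]

theorem countablySeparated_of_represents [T2Space L] {R : Set L} (hR : IsCompact R)
    [SecondCountableTopology R] {B : Set K} [CompactSpace K] [T2Space K]
    (h : ∀ x ∈ B, ∃ (n : ℕ) (a : Fin n → ℝ) (y : Fin n → R),
      Represents T x a fun i => (y i : L)) : CountablySeparated B := by
  have : CompactSpace R := isCompact_iff_compactSpace.1 hR
  let res : Cp K → C(R, ℝ) := fun f => ⟨fun y => (T f).1 y, (T f).2.comp continuous_subtype_val⟩
  obtain ⟨t, -, htc, ht⟩ := exists_countable_subset_image_subset_closure res univ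
  have htne : t.Nonempty := by
    by_contra hne
    rw [not_nonempty_iff_eq_empty.1 hne, image_empty, closure_empty] at ht
    exact ht (mem_image_of_mem res (mem_univ 0))
  obtain ⟨f, rfl⟩ := htc.exists_eq_range htne
  refine ⟨fun n => ⟨(f n).1, (f n).2⟩, fun x hx x' hx' hxx => eq_of_forall_cp_eq fun g => ?_⟩
  obtain ⟨n, a, y, hxr⟩ := h x hx
  obtain ⟨n', a', y', hxr'⟩ := h x' hx'
  have hcl : IsClosed {φ : C(R, ℝ) | ∑ i, a i * φ (y i) = ∑ i, a' i * φ (y' i)} :=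
    isClosed_eq (by fun_prop) (by fun_prop)
  have hsub : res '' range f ⊆ {φ : C(R, ℝ) | ∑ i, a i * φ (y i) = ∑ i, a' i * φ (y' i)} := by
    rintro _ ⟨_, ⟨k, rfl⟩, rfl⟩
    exact (hxr (f k)).symm.trans ((hxx k).trans (hxr' (f k)))
  have := closure_minimal hsub hcl (ht (mem_image_of_mem res (mem_univ g)))
  exact (hxr g).trans (Eq.trans this (hxr' g).symm)

theorem secondCountableTopology_of_support_subset {Γ : Type u} {X : Type*} [TopologicalSpace X]
    [SecondCountableTopology X] [T2Space X] {o : X} {e : L → Γ → X} (he : IsEmbedding e)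
    {S : Set Γ} (hS : S.Countable) {R : Set L} (hR : IsCompact R)
    (hRS : ∀ y ∈ R, {γ | e y γ ≠ o} ⊆ S) : SecondCountableTopology R := by
  have : CompactSpace R := isCompact_iff_compactSpace.1 hR
  have := hS.to_subtype
  have hcont : Continuous fun (y : R) (γ : S) => e y γ :=
    continuous_pi fun γ => (continuous_apply _).comp (he.continuous.comp continuous_subtype_val)
  refine (hcont.isClosedEmbedding fun y y' hyy => ?_).isEmbedding.secondCountableTopology
  refine Subtype.ext (he.injective ?_)
  rw [← truncate_eq_self (hRS y y.2), ← truncate_eq_self (hRS y' y'.2)]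
  funext γ
  by_cases hγ : γ ∈ S
  · simpa only [truncate_of_mem o _ hγ] using congrFun hyy ⟨γ, hγ⟩
  · simp only [truncate_of_notMem o _ hγ]

theorem exists_retractionSystem [CompactSpace K] [T2Space K] [CompactSpace L] [T2Space L] {Γ : Type u}
    {X : Type*} [TopologicalSpace X] [T2Space X] [SecondCountableTopology X] (hT : IsInducing T)
    (hTc : IsClosed (range T)) {o : X} {e : L → Γ → X} (he : IsEmbedding e)
    (hfin : ∀ y, {γ | e y γ ≠ o}.Finite) : Nonempty (RetractionSystem K Γ) := by
  obtain ⟨c, r, ρ, hc, h⟩ := exists_retractions hT hTc he hfin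
  choose hr hrc hρc hρ using h
  have hrep := exists_represents hT
  have hrr : ∀ {S S'} (_ : ClosedUnder c S) (_ : ClosedUnder c S'), S ⊆ S' →
      ∀ y, r S (r S' y) = r S y := by
    intro S S' hS hS' hSS y
    apply he.injective
    rw [hr S hS, hr S' hS', hr S hS, truncate_truncate, inter_eq_left.2 hSS]
  have hrr' : ∀ {S S'} (_ : ClosedUnder c S) (_ : ClosedUnder c S'), S ⊆ S' →
      ∀ y, r S' (r S y) = r S y := by
    intro S S' hS hS' hSS y
    apply he.injective
    rw [hr S' hS', hr S hS, truncate_truncate, inter_eq_right.2 hSS]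
  have hsupp : ∀ {S} (_ : ClosedUnder c S) (y : L), {γ | e (r S y) γ ≠ o} ⊆ S := by
    intro S hS y
    rw [hr S hS]
    exact setOf_truncate_ne_subset o S _
  have hr_self : ∀ {S} (_ : ClosedUnder c S) (y : L), {γ | e y γ ≠ o} ⊆ S → r S y = y := by
    intro S hS y hy
    apply he.injective
    rw [hr S hS, truncate_eq_self hy]
  refine ⟨⟨c, hc, ρ, fun hS => hρc _ hS, ?_, ?_, ?_, ?_, ?_⟩⟩
  · intro S S' hS hS' hSS x
    obtain ⟨n, a, y, hx⟩ := hrep x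
    have h1 := hρ S hS _ n a _ (hρ S' hS' x n a y hx)
    simp only [hrr hS hS' hSS] at h1
    exact h1.eq (hρ S hS x n a y hx)
  · intro S S' hS hS' hSS x
    obtain ⟨n, a, y, hx⟩ := hrep x
    have h1 := hρ S' hS' _ n a _ (hρ S hS x n a y hx)
    simp only [hrr' hS hS' hSS] at h1
    exact h1.eq (hρ S hS x n a y hx)
  · intro 𝒮 hne hdir hcl x hx
    have hU := closedUnder_sUnion hne hdir hcl
    obtain ⟨n, a, y, hxr⟩ := hrep x
    have h1 := hρ _ hU x n a y hxr
    rw [hx] at h1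
    have hF : (⋃ i, {γ | e (r (⋃₀ 𝒮) (y i)) γ ≠ o}).Finite := finite_iUnion fun i => hfin _
    obtain ⟨S, hS, hFS⟩ := exists_mem_finset_subset_of_directedOn hne hdir hF.toFinset (by
      rw [hF.coe_toFinset]
      exact iUnion_subset fun i => hsupp hU _)
    rw [hF.coe_toFinset] at hFS
    refine ⟨S, hS, ?_⟩
    have h2 := hρ S (hcl S hS) x n a _ h1
    simp only [fun i => hr_self (hcl S hS) _ ((subset_iUnion _ i).trans hFS)] at h2
    exact h2.eq h1
  · intro S hS hcount
    have hR : IsCompact (range (r S)) := isCompact_range (hrc S hS)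
    have := secondCountableTopology_of_support_subset he hcount hR
      (forall_mem_range.2 (hsupp hS))
    refine countablySeparated_of_represents (T := T) hR fun x (hx : ρ S x = x) => ?_
    obtain ⟨n, a, y, hxr⟩ := hrep x
    have h1 := hρ S hS x n a y hxr
    rw [hx] at h1
    exact ⟨n, a, fun i => ⟨r S (y i), mem_range_self _⟩, h1⟩
  · intro x
    obtain ⟨n, a, y, hxr⟩ := hrep x
    have h1 := hρ univ (closedUnder_univ c) x n a y hxr
    simp only [hr_self (closedUnder_univ c) _ (subset_univ _)] at h1
    exact h1.eq hxr

end Representation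

/-- Let `K` and `L` be compact Hausdorff spaces, and let `T : C_p(K) → C_p(L)` be a
linear map which is a homeomorphism onto its image, with closed image. If `L` is NY
compact, then `K` is NY compact as well. -/
theorem stmt13 (K L : Type u) [TopologicalSpace K] [CompactSpace K] [T2Space K]
    [TopologicalSpace L] [CompactSpace L] [T2Space L]
    (T : Cp K →ₗ[ℝ] Cp L)
    (hTemb : Topology.IsEmbedding T) (hTclosed : IsClosed (Set.range T))
    (hL : IsNYCompact L) :
    IsNYCompact K := by
  obtain ⟨-, -, Γ, e, he, hfin⟩ := hL
  obtain ⟨R⟩ := exists_retractionSystem hTemb.isInducing hTclosed he hfin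
  exact R.isNYCompact
end

section
/- Let κ be a regular uncountable cardinal and let K be a compact Hausdorff space. Then K is κ-Corson compact if and only if C_p(K) is a continuous image of a closed subspace of L_κ(λ)^ω for some cardinal λ. -/
universe u

/-- The underlying set of the space `L_κ(λ)`: the disjoint union of `Λ` (a set of
cardinality `λ`) and the point `∞` (here `none`). -/
def LSpace (κ : Cardinal.{u}) (Λ : Type u) : Type u := Option Λ

/-- The distinguished point `∞` of `L_κ(λ)`. -/
def LSpace.infty (κ : Cardinal.{u}) (Λ : Type u) : LSpace κ Λ := none

/-- The inclusion of `Λ` (the isolated points) into `L_κ(λ)`. -/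
def LSpace.mk (κ : Cardinal.{u}) {Λ : Type u} (a : Λ) : LSpace κ Λ := some a

/-- The topology of `L_κ(λ)`: every point of `Λ` is isolated, and the neighbourhoods of
`∞` are the sets containing `∞` whose complement in `Λ` has cardinality `< κ`.
(For infinite `κ`, the generating family is already a topology.) -/
instance (κ : Cardinal.{u}) (Λ : Type u) : TopologicalSpace (LSpace κ Λ) :=
  TopologicalSpace.generateFrom
    {U : Set (LSpace κ Λ) |
      LSpace.infty κ Λ ∈ U → Cardinal.mk ↥{a : Λ | LSpace.mk κ a ∉ U} < κ}

/-- A space is `κ`-Corson compact if it is a compact Hausdorff space homeomorphic to a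
subspace of `Σ_κ(ℝ^Γ) = {x ∈ ℝ^Γ : |{γ : x γ ≠ 0}| < κ}` (with the topology of pointwise
convergence) for some index set `Γ`. For `κ = ℵ₀` this is ω-Corson compactness. -/
def IsKappaCorson (κ : Cardinal.{u}) (K : Type u) [TopologicalSpace K] : Prop :=
  CompactSpace K ∧ T2Space K ∧
    ∃ (Γ : Type u) (f : K → Γ → ℝ),
      Topology.IsEmbedding f ∧ ∀ k, Cardinal.mk ↥{γ | f k γ ≠ 0} < κ

section CardinalBounds

open Cardinal Set

theorem mk_iUnion_nat_lt {κ : Cardinal.{u}} (hreg : κ.IsRegular) (hunc : ℵ₀ < κ) {α : Type u}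
    {t : ℕ → Set α} (ht : ∀ i, #(t i) < κ) : #(⋃ i, t i) < κ := by
  have h : ⋃ i, t i = ⋃ i : ULift.{u} ℕ, t i.down := (Equiv.ulift.iSup_comp (g := t)).symm
  rw [h, card_iUnion_lt_iff_forall_of_isRegular hreg (by simpa using hunc)]
  exact fun i => ht i.down

theorem mk_finite_biUnion_lt {κ : Cardinal.{u}} (hκ : ℵ₀ ≤ κ) {ι : Type*} {α : Type u}
    {s : Set ι} (hs : s.Finite) {t : ι → Set α} (ht : ∀ i ∈ s, #(t i) < κ) :
    #(⋃ i ∈ s, t i : Set α) < κ := by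
  induction s, hs using Set.Finite.induction_on with
  | empty => simpa using aleph0_pos.trans_le hκ
  | @insert a s _ _ ih =>
    rw [biUnion_insert]
    exact (mk_union_le _ _).trans_lt (add_lt_of_lt hκ (ht a (mem_insert a s))
      (ih fun i hi => ht i (mem_insert_of_mem a hi)))

end CardinalBounds

namespace LSpace

open Cardinal Set Topology Filter

variable {κ : Cardinal.{u}} {Λ : Type u}

theorem eq_infty_or_mk (x : LSpace κ Λ) : x = infty κ Λ ∨ ∃ a, x = mk κ a := by
  cases x with
  | none => exact Or.inl rfl
  | some a => exact Or.inr ⟨a, rfl⟩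

theorem mk_injective : Function.Injective (mk κ : Λ → LSpace κ Λ) :=
  Option.some_injective Λ

theorem mk_ne_infty (a : Λ) : mk κ a ≠ infty κ Λ :=
  Option.some_ne_none a

theorem isOpen_iff (hκ : ℵ₀ ≤ κ) {O : Set (LSpace κ Λ)} :
    IsOpen O ↔ (infty κ Λ ∈ O → #{a : Λ | mk κ a ∉ O} < κ) := by
  refine ⟨fun hO => ?_, fun h => TopologicalSpace.isOpen_generateFrom_of_mem h⟩
  induction hO with
  | basic s hs => exact hs
  | univ => simpa using aleph0_pos.trans_le hκ
  | inter s t _ _ hs ht =>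
    intro h
    refine (mk_le_mk_of_subset ?_).trans_lt ((mk_union_le _ _).trans_lt
      (add_lt_of_lt hκ (hs h.1) (ht h.2)))
    intro a ha
    by_contra hc
    simp only [mem_union, mem_ofPred_eq, not_or, not_not] at hc
    exact ha hc
  | sUnion S _ ih =>
    rintro ⟨s, hs, h⟩
    have hsub : {a : Λ | mk κ a ∉ ⋃₀ S} ⊆ {a | mk κ a ∉ s} := fun a ha hc => ha ⟨s, hs, hc⟩
    exact (mk_le_mk_of_subset hsub).trans_lt (ih s hs h)

theorem mk_compl_lt_of_mem_nhds (hκ : ℵ₀ ≤ κ) {O : Set (LSpace κ Λ)} (hO : O ∈ 𝓝 (infty κ Λ)) :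
    #{a : Λ | mk κ a ∉ O} < κ := by
  obtain ⟨V, hVO, hV, hmem⟩ := mem_nhds_iff.mp hO
  have hsub : {a : Λ | mk κ a ∉ O} ⊆ {a | mk κ a ∉ V} := fun a ha hc => ha (hVO hc)
  exact (mk_le_mk_of_subset hsub).trans_lt ((isOpen_iff hκ).mp hV hmem)

/-- `z` lies in the basic neighbourhood of `x` that is given by the first `n` coordinates and the
exceptional set `U`. -/
def Near (n : ℕ) (U : Set Λ) (x z : ℕ → LSpace κ Λ) : Prop :=
  ∀ i < n, z i = x i ∨ (x i = infty κ Λ ∧ ∀ a ∈ U, z i ≠ mk κ a)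

theorem exists_near (hκ : ℵ₀ ≤ κ) {x : ℕ → LSpace κ Λ} {O : Set (ℕ → LSpace κ Λ)}
    (hO : O ∈ 𝓝 x) : ∃ (n : ℕ) (U : Set Λ), #U < κ ∧ ∀ z, Near n U x z → z ∈ O := by
  rw [nhds_pi, Filter.mem_pi] at hO
  obtain ⟨I, hI, t, ht, hsub⟩ := hO
  obtain ⟨n, hn⟩ := hI.bddAbove
  refine ⟨n + 1, ⋃ i ∈ I, {a | x i = infty κ Λ ∧ mk κ a ∉ t i},
    mk_finite_biUnion_lt hκ hI fun i _ => ?_, fun z hz => hsub fun i hi => ?_⟩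
  · by_cases h : x i = infty κ Λ
    · simp only [h, true_and]
      exact mk_compl_lt_of_mem_nhds hκ (h ▸ ht i)
    · simpa [h] using aleph0_pos.trans_le hκ
  · rcases hz i (Nat.lt_succ_of_le (hn hi)) with h | ⟨h, h'⟩
    · exact h ▸ mem_of_mem_nhds (ht i)
    · rcases eq_infty_or_mk (z i) with h0 | ⟨a, ha⟩
      · exact (h0.trans h.symm) ▸ mem_of_mem_nhds (ht i)
      · by_contra hc
        exact h' a (mem_biUnion hi ⟨h, ha ▸ hc⟩) ha

open Classical in
/-- The retraction of `L_κ(λ)` that fixes the points of `A` and sends all others to `∞`. -/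
noncomputable def retract (A : Set Λ) (x : LSpace κ Λ) : LSpace κ Λ :=
  if ∃ a ∈ A, x = mk κ a then x else infty κ Λ

@[simp]
theorem retract_infty (A : Set Λ) : retract A (infty κ Λ) = infty κ Λ := by
  simp [retract]

theorem retract_mk_of_mem {A : Set Λ} {a : Λ} (ha : a ∈ A) : retract A (mk κ a) = mk κ a :=
  if_pos ⟨a, ha, rfl⟩

theorem retract_mk_of_notMem {A : Set Λ} {a : Λ} (ha : a ∉ A) :
    retract A (mk κ a) = infty κ Λ := by
  refine if_neg ?_
  rintro ⟨b, hb, h⟩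
  exact ha (mk_injective h ▸ hb)

theorem retract_eq_self_or_infty (A : Set Λ) (x : LSpace κ Λ) :
    retract A x = x ∨ retract A x = infty κ Λ := by
  unfold retract
  split_ifs <;> simp

theorem retract_eq_mk {A : Set Λ} {x : LSpace κ Λ} {a : Λ} (h : retract A x = mk κ a) :
    a ∈ A ∧ x = mk κ a := by
  unfold retract at h
  split_ifs at h with hx
  · obtain ⟨b, hb, rfl⟩ := hx
    exact ⟨mk_injective h ▸ hb, h⟩
  · exact (mk_ne_infty a h.symm).elim

theorem retract_univ (x : LSpace κ Λ) : retract univ x = x := by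
  rcases eq_infty_or_mk x with rfl | ⟨a, rfl⟩
  · exact retract_infty _
  · exact retract_mk_of_mem (mem_univ a)

theorem retract_retract_of_superset {A B : Set Λ} (h : A ⊆ B) (x : LSpace κ Λ) :
    retract A (retract B x) = retract A x := by
  rcases eq_infty_or_mk x with rfl | ⟨a, rfl⟩
  · simp
  · by_cases ha : a ∈ B
    · rw [retract_mk_of_mem ha]
    · rw [retract_mk_of_notMem ha, retract_mk_of_notMem fun h' => ha (h h'), retract_infty]

theorem retract_congr {A B : Set Λ} {x : LSpace κ Λ} (h : ∀ a, x = mk κ a → (a ∈ A ↔ a ∈ B)) :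
    retract A x = retract B x := by
  rcases eq_infty_or_mk x with rfl | ⟨a, rfl⟩
  · simp
  · by_cases ha : a ∈ A
    · rw [retract_mk_of_mem ha, retract_mk_of_mem ((h a rfl).mp ha)]
    · rw [retract_mk_of_notMem ha, retract_mk_of_notMem fun hb => ha ((h a rfl).mpr hb)]

theorem continuous_retract (A : Set Λ) : Continuous (retract A : LSpace κ Λ → LSpace κ Λ) := by
  refine continuous_generateFrom_iff.mpr fun O hO =>
    TopologicalSpace.isOpen_generateFrom_of_mem fun h => ?_
  have h' : infty κ Λ ∈ O := by simpa using h
  have hsub : {a : Λ | mk κ a ∉ retract A ⁻¹' O} ⊆ {a | mk κ a ∉ O} := by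
    intro a ha hc
    refine ha ?_
    rcases retract_eq_self_or_infty A (mk κ a) with h0 | h0
    · simpa [h0] using hc
    · simpa [h0] using h'
  exact (mk_le_mk_of_subset hsub).trans_lt (hO h')

/-- The coordinatewise extension of `LSpace.retract` to `L_κ(λ)^ω`. -/
noncomputable def retractSeq (A : Set Λ) (x : ℕ → LSpace κ Λ) : ℕ → LSpace κ Λ :=
  fun i => retract A (x i)

theorem retractSeq_retractSeq_of_superset {A B : Set Λ} (h : A ⊆ B) (x : ℕ → LSpace κ Λ) :
    retractSeq A (retractSeq B x) = retractSeq A x :=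
  funext fun _ => retract_retract_of_superset h _

theorem continuous_retractSeq (A : Set Λ) :
    Continuous (retractSeq A : (ℕ → LSpace κ Λ) → ℕ → LSpace κ Λ) :=
  continuous_pi fun i => (continuous_retract A).comp (continuous_apply i)

theorem eq_zero_of_forall_agree {F : Set (ℕ → LSpace κ Λ)} {f : (ℕ → LSpace κ Λ) → ℝ}
    (hf : ContinuousOn f F) {y : ℕ → LSpace κ Λ} (hy : y ∈ F)
    (h : ∀ n, ∃ z ∈ F, (∀ i < n, z i = y i) ∧ f z = 0) : f y = 0 := by
  choose z hzF hz hfz using h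
  have hlim : Tendsto z atTop (𝓝[F] y) := by
    refine tendsto_nhdsWithin_iff.mpr ⟨tendsto_pi_nhds.mpr fun i => ?_, .of_forall hzF⟩
    refine tendsto_const_nhds.congr' ?_
    filter_upwards [eventually_gt_atTop i] with n hn using (hz n i hn).symm
  have := (hf y hy).tendsto.comp hlim
  simp only [Function.comp_def, hfz] at this
  exact (tendsto_nhds_unique this tendsto_const_nhds)

/-- The finite sequences in `L_κ(λ)` all of whose entries lie in `A ∪ {∞}`. -/
def listsIn (κ : Cardinal.{u}) (A : Set Λ) : Set (List (LSpace κ Λ)) :=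
  {l | ∀ a, mk κ a ∈ l → a ∈ A}

theorem listsIn_mono {A B : Set Λ} (h : A ⊆ B) : listsIn κ A ⊆ listsIn κ B :=
  fun _ hl a ha => h (hl a ha)

theorem mk_listsIn_lt (hunc : ℵ₀ < κ) {A : Set Λ} (hA : #A < κ) : #(listsIn κ A) < κ := by
  have hsub : listsIn κ A ⊆
      range (List.map (fun o : Option A => (o.elim (infty κ Λ) fun a => mk κ a.1))) := by
    intro l hl
    rw [range_list_map]
    intro x hx
    rcases eq_infty_or_mk x with rfl | ⟨a, rfl⟩
    · exact ⟨none, rfl⟩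
    · exact ⟨some ⟨a, hl a hx⟩, rfl⟩
  refine (mk_le_mk_of_subset hsub).trans_lt (mk_range_le.trans_lt
    ((mk_list_le_max _).trans_lt (max_lt hunc ?_)))
  rw [mk_option]
  exact add_lt_of_lt hunc.le hA (one_lt_aleph0.trans hunc)

/-- `A` is closed under the set-valued operation `U` on finite sequences. -/
def IsHullClosed (U : List (LSpace κ Λ) → Set Λ) (A : Set Λ) : Prop :=
  ∀ l ∈ listsIn κ A, U l ⊆ A

/-- The smallest `U`-closed set that contains `S`. -/
def hull (U : List (LSpace κ Λ) → Set Λ) (S : Set Λ) : Set Λ :=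
  ⋂₀ {A | S ⊆ A ∧ IsHullClosed U A}

section Hull

variable (U : List (LSpace κ Λ) → Set Λ)

theorem subset_hull (S : Set Λ) : S ⊆ hull U S :=
  subset_sInter fun _ hA => hA.1

theorem isHullClosed_hull (S : Set Λ) : IsHullClosed U (hull U S) :=
  fun l hl => subset_sInter fun _ hA =>
    hA.2 l (listsIn_mono (sInter_subset_of_mem hA) hl)

variable {U}

theorem hull_subset {S A : Set Λ} (h : S ⊆ A) (hA : IsHullClosed U A) : hull U S ⊆ A :=
  sInter_subset_of_mem ⟨h, hA⟩

theorem hull_mono {S T : Set Λ} (h : S ⊆ T) : hull U S ⊆ hull U T :=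
  hull_subset (h.trans (subset_hull U T)) (isHullClosed_hull U T)

theorem exists_finite_hull {S : Set Λ} {a : Λ} (ha : a ∈ hull U S) :
    ∃ t ⊆ S, t.Finite ∧ a ∈ hull U t := by
  refine hull_subset (A := {a | ∃ t ⊆ S, t.Finite ∧ a ∈ hull U t}) ?_ ?_ ha
  · intro b hb
    exact ⟨{b}, by simpa using hb, finite_singleton b, subset_hull U _ rfl⟩
  · intro l hl b hb
    choose! t htS htf ht using hl
    have hfin : {a | mk κ a ∈ l}.Finite := l.finite_toSet.preimage mk_injective.injOn
    refine ⟨⋃ a ∈ {a | mk κ a ∈ l}, t a, iUnion₂_subset htS, hfin.biUnion htf, ?_⟩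
    refine isHullClosed_hull U _ l (fun a ha => ?_) hb
    exact hull_mono (subset_biUnion_of_mem (u := t) (show a ∈ {a | mk κ a ∈ l} from ha)) (ht a ha)

theorem exists_finite_hull_of_finite {S E : Set Λ} (hE : E.Finite) (hES : E ⊆ hull U S) :
    ∃ t ⊆ S, t.Finite ∧ E ⊆ hull U t := by
  choose! t htS htf ht using fun a (ha : a ∈ E) => exists_finite_hull (hES ha)
  exact ⟨⋃ a ∈ E, t a, iUnion₂_subset htS, hE.biUnion htf,
    fun a ha => hull_mono (subset_biUnion_of_mem (u := t) ha) (ht a ha)⟩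

theorem mk_hull_lt (hreg : κ.IsRegular) (hunc : ℵ₀ < κ) (hU : ∀ l, #(U l) < κ) {S : Set Λ}
    (hS : #S < κ) : #(hull U S) < κ := by
  let step : Set Λ → Set Λ := fun A => A ∪ ⋃ l : listsIn κ A, U l
  have hle : ∀ A, A ⊆ step A := fun _ => subset_union_left
  have hmono : Monotone fun n => step^[n] S := monotone_nat_of_le_succ fun n => by
    rw [Function.iterate_succ_apply']
    exact hle _
  have hcard : ∀ n, #(step^[n] S) < κ := by
    intro n
    induction n with
    | zero => exact hS
    | succ n ih =>
      rw [Function.iterate_succ_apply']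
      refine (mk_union_le _ _).trans_lt (add_lt_of_lt hunc.le ih ?_)
      exact (card_iUnion_lt_iff_forall_of_isRegular hreg (mk_listsIn_lt hunc ih)).mpr
        fun l => hU l
  refine (mk_le_mk_of_subset (hull_subset (subset_iUnion (fun n => step^[n] S) 0) ?_)).trans_lt
    (mk_iUnion_nat_lt hreg hunc hcard)
  intro l hl
  have hfin : {a | mk κ a ∈ l}.Finite := l.finite_toSet.preimage mk_injective.injOn
  obtain ⟨N, hN⟩ := (directed_of_isDirected_le hmono).exists_mem_subset_of_finset_subset_biUnion
    (s := hfin.toFinset) (by intro a ha; exact hl a (by simpa using ha))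
  refine subset_trans ?_ (subset_iUnion (fun n => step^[n] S) (N + 1))
  simp only [Function.iterate_succ_apply']
  refine subset_union_of_subset_right ?_ _
  exact subset_iUnion (fun l : listsIn κ (step^[N] S) => U l)
    ⟨l, fun a ha => hN (by simpa using ha)⟩

end Hull

theorem exists_isHullClosed_retractSeq_mem (hκ : ℵ₀ ≤ κ) {F : Set (ℕ → LSpace κ Λ)}
    (hF : IsClosed F) : ∃ U : List (LSpace κ Λ) → Set Λ, (∀ l, #(U l) < κ) ∧
      ∀ A, IsHullClosed U A → ∀ x ∈ F, retractSeq A x ∈ F := by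
  have key : ∀ l : List (LSpace κ Λ), ∃ V : Set Λ, #V < κ ∧
      ((∃ W : Set Λ, #W < κ ∧ ∀ x ∈ F, ¬ Near l.length W (fun i => l.getD i (infty κ Λ)) x) →
        ∀ x ∈ F, ¬ Near l.length V (fun i => l.getD i (infty κ Λ)) x) := by
    intro l
    by_cases h : ∃ W : Set Λ, #W < κ ∧
        ∀ x ∈ F, ¬ Near l.length W (fun i => l.getD i (infty κ Λ)) x
    · obtain ⟨W, hW, h'⟩ := h
      exact ⟨W, hW, fun _ => h'⟩
    · exact ⟨∅, by simpa using aleph0_pos.trans_le hκ, fun h' => (h h').elim⟩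
  choose U hU hUF using key
  refine ⟨U, hU, fun A hA x hx => ?_⟩
  by_contra hc
  obtain ⟨n, W, hW, hnear⟩ := exists_near hκ (hF.isOpen_compl.mem_nhds hc)
  set l := (List.range n).map (retractSeq A x) with hl
  have hlen : l.length = n := by simp [hl]
  have hget : ∀ i < n, l.getD i (infty κ Λ) = retractSeq A x i := by
    intro i hi
    simp [hl, List.getD, hi]
  have hlA : l ∈ listsIn κ A := by
    intro a ha
    obtain ⟨i, -, hi⟩ := List.mem_map.mp ha
    exact (retract_eq_mk hi).1
  refine hUF l ⟨W, hW, fun y hy hy' => hnear y (fun i hi => ?_) hy⟩ x hx fun i hi => ?_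
  · simpa only [hget i hi] using hy' i (hlen ▸ hi)
  · beta_reduce
    rw [hget i (hlen ▸ hi)]
    rcases retract_eq_self_or_infty A (x i) with h | h
    · exact Or.inl h.symm
    · refine Or.inr ⟨h, fun a ha hxa => ?_⟩
      rw [hxa, retract_mk_of_mem (hA l hlA ha)] at h
      exact mk_ne_infty a h

end LSpace

namespace LSpace

open Cardinal Set Topology Filter

variable {κ : Cardinal.{u}} {Λ : Type u}

theorem exists_forall_le_mk_near (hreg : κ.IsRegular) (hunc : ℵ₀ < κ) {G : Type u} (hG : κ ≤ #G)
    (p : G → ℕ → LSpace κ Λ) : ∃ x : ℕ → LSpace κ Λ, ∀ (n : ℕ) (U : Set Λ), #U < κ →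
      κ ≤ #{γ | Near n U x (p γ)} := by
  have key : ∀ (n : ℕ) (W : {W : Set G // κ ≤ #W}), ∃ (y : LSpace κ Λ) (W' : {W : Set G // κ ≤ #W}),
      W'.1 ⊆ W.1 ∧ ((∀ γ ∈ W'.1, p γ n = y) ∨
        (y = infty κ Λ ∧ ∀ a, #{γ | γ ∈ W'.1 ∧ p γ n = mk κ a} < κ)) := by
    intro n W
    by_cases h : ∃ a, κ ≤ #{γ | γ ∈ W.1 ∧ p γ n = mk κ a}
    · obtain ⟨a, ha⟩ := h
      exact ⟨mk κ a, ⟨_, ha⟩, fun γ hγ => hγ.1, Or.inl fun γ hγ => hγ.2⟩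
    · push Not at h
      exact ⟨infty κ Λ, W, subset_rfl, Or.inr ⟨rfl, h⟩⟩
  choose y W' hsub hW' using key
  let W : ℕ → {W : Set G // κ ≤ #W} := fun n => Nat.rec ⟨univ, by simpa using hG⟩ W' n
  have hanti : Antitone fun n => (W n).1 := antitone_nat_of_succ_le fun n => hsub n (W n)
  refine ⟨fun n => y n (W n), fun n U hU => ?_⟩
  by_contra! hlt
  let B : ℕ → Set G := fun i => {γ | γ ∈ (W (i + 1)).1 ∧
    ¬ (p γ i = y i (W i) ∨ (y i (W i) = infty κ Λ ∧ ∀ a ∈ U, p γ i ≠ mk κ a))}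
  have hB : ∀ i, #(B i) < κ := by
    intro i
    rcases hW' i (W i) with h | ⟨h, h'⟩
    · have : B i = ∅ := eq_empty_of_forall_notMem fun γ hγ => hγ.2 (Or.inl (h γ hγ.1))
      simpa [this] using aleph0_pos.trans hunc
    · have hBU : B i ⊆ ⋃ a ∈ U, {γ | γ ∈ (W (i + 1)).1 ∧ p γ i = mk κ a} := by
        intro γ hγ
        have := hγ.2
        push Not at this
        obtain ⟨a, ha, hγa⟩ := this.2 h
        exact mem_biUnion ha ⟨hγ.1, hγa⟩
      exact (mk_le_mk_of_subset hBU).trans_lt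
        ((card_biUnion_lt_iff_forall_of_isRegular hreg hU).mpr fun a _ => h' a)
  have hcover : (W n).1 ⊆ {γ | Near n U (fun n => y n (W n)) (p γ)} ∪ ⋃ i, B i := by
    intro γ hγ
    by_cases hc : Near n U (fun n => y n (W n)) (p γ)
    · exact Or.inl hc
    · unfold Near at hc
      push Not at hc
      obtain ⟨i, hi, h1, h2⟩ := hc
      refine Or.inr (mem_iUnion.mpr ⟨i, hanti (Nat.succ_le_of_lt hi) hγ, ?_⟩)
      push Not
      exact ⟨h1, h2⟩
  exact ((W n).2.trans ((mk_le_mk_of_subset hcover).trans (mk_union_le _ _))).not_gt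
    (add_lt_of_lt hunc.le hlt (mk_iUnion_nat_lt hreg hunc hB))

theorem mk_setOf_retractSeq_ne_lt (hreg : κ.IsRegular) (hunc : ℵ₀ < κ)
    {F : Set (ℕ → LSpace κ Λ)} (hF : IsClosed F) {I : Type u} [LinearOrder I] {B B' : I → Set Λ}
    (hB : ∀ i, B i ⊆ B' i) (hB' : ∀ i j, i < j → B' i ⊆ B j)
    (hBF : ∀ i, ∀ x ∈ F, retractSeq (B i) x ∈ F) (hBF' : ∀ i, ∀ x ∈ F, retractSeq (B' i) x ∈ F)
    {f : (ℕ → LSpace κ Λ) → ℝ} (hf : ContinuousOn f F) :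
    #{i | ∃ x ∈ F, f (retractSeq (B' i) x) ≠ f (retractSeq (B i) x)} < κ := by
  have hcover : {i | ∃ x ∈ F, f (retractSeq (B' i) x) ≠ f (retractSeq (B i) x)} ⊆
      ⋃ n : ℕ, {i | ∃ x ∈ F, 1 / ((n : ℝ) + 1) <
        |f (retractSeq (B' i) x) - f (retractSeq (B i) x)|} := by
    rintro i ⟨x, hx, hne⟩
    obtain ⟨n, hn⟩ := exists_nat_one_div_lt (abs_pos.mpr (sub_ne_zero.mpr hne))
    exact mem_iUnion.mpr ⟨n, x, hx, hn⟩
  refine (mk_le_mk_of_subset hcover).trans_lt (mk_iUnion_nat_lt hreg hunc fun m => ?_)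
  by_contra! hS
  set ε : ℝ := 1 / ((m : ℝ) + 1) with hε
  have hεpos : 0 < ε := by positivity
  choose x hxF hx using fun i : {i | ∃ x ∈ F, ε <
    |f (retractSeq (B' i) x) - f (retractSeq (B i) x)|} => i.2
  obtain ⟨y, hy⟩ := exists_forall_le_mk_near hreg hunc hS fun i => retractSeq (B' i) (x i)
  have hyF : y ∈ F := by
    by_contra hc
    obtain ⟨n, U, hU, hnear⟩ := exists_near hunc.le (hF.isOpen_compl.mem_nhds hc)
    obtain ⟨i, hi⟩ := mk_ne_zero_iff.mp ((aleph0_pos.trans hunc).trans_le (hy n U hU)).ne'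
    exact hnear _ hi (hBF' _ _ (hxF i))
  have hnhds : {z | z ∈ F → |f z - f y| < ε / 2} ∈ 𝓝 y := by
    have := (hf y hyF).tendsto.eventually (Metric.ball_mem_nhds (f y) (half_pos hεpos))
    exact eventually_nhdsWithin_iff.mp (by simpa only [Metric.mem_ball, Real.dist_eq] using this)
  obtain ⟨n, U, hU, hnear⟩ := exists_near hunc.le hnhds
  have := one_lt_iff_nontrivial.mp ((one_lt_aleph0.trans hunc).trans_le (hy n U hU))
  obtain ⟨⟨i, hi⟩, ⟨j, hj⟩, hij⟩ := @exists_pair_lt _ this _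
  have hBj : Near n U y (retractSeq (B j) (x j)) := by
    intro k hk
    have hret : retractSeq (B j) (x j) k = retract (B j) (retractSeq (B' j) (x j) k) :=
      (retract_retract_of_superset (hB j) _).symm
    rw [hret]
    rcases retract_eq_self_or_infty (B j) (retractSeq (B' j) (x j) k) with h | h
    · rw [h]
      exact hj k hk
    · rw [h]
      rcases eq_infty_or_mk (y k) with hyk | ⟨a, hyk⟩
      · exact Or.inl hyk.symm
      · have hik : retractSeq (B' i) (x i) k = mk κ a :=
          (hi k hk).elim (fun h => h.trans hyk) fun h => (mk_ne_infty a (hyk.symm.trans h.1)).elim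
        have hjk : retractSeq (B' j) (x j) k = mk κ a :=
          (hj k hk).elim (fun h => h.trans hyk) fun h => (mk_ne_infty a (hyk.symm.trans h.1)).elim
        rw [hjk, retract_mk_of_mem (hB' i j hij (retract_eq_mk hik).1)] at h
        exact (mk_ne_infty a h).elim
  have h1 := hnear _ hj (hBF' _ _ (hxF j))
  have h2 := hnear _ hBj (hBF _ _ (hxF j))
  have h3 := hx j
  have h4 := abs_sub_le (f (retractSeq (B' j) (x j))) (f y) (f (retractSeq (B j) (x j)))
  rw [abs_sub_comm (f y)] at h4
  linarith

/-- There is a family of functionals, each continuous for pointwise convergence, of which fewer than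
`κ` do not vanish at a given function continuous on `F`, and which determine such a function on
the retract of `F` given by `A`. -/
def HasSmallFunctionals (F : Set (ℕ → LSpace κ Λ)) (A : Set Λ) : Prop :=
  ∃ (Γ : Type u) (T : Γ → (((ℕ → LSpace κ Λ) → ℝ) →L[ℝ] ℝ)),
    (∀ f, (∀ x ∈ F, f x = 0) → ∀ γ, T γ f = 0) ∧
    (∀ f, ContinuousOn f F → #{γ | T γ f ≠ 0} < κ) ∧
    ∀ f, ContinuousOn f F → (∀ γ, T γ f = 0) → ∀ x ∈ F, f (retractSeq A x) = 0

open Classical in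
theorem hasSmallFunctionals_of_mk_lt (hunc : ℵ₀ < κ) {F : Set (ℕ → LSpace κ Λ)} {A : Set Λ}
    (hA : #A < κ) (hAF : ∀ x ∈ F, retractSeq A x ∈ F) : HasSmallFunctionals F A := by
  let T : listsIn κ A → (((ℕ → LSpace κ Λ) → ℝ) →L[ℝ] ℝ) := fun l =>
    if h : ∃ z ∈ F, (List.range l.1.length).map z = l.1 then
      ContinuousLinearMap.proj h.choose else 0
  refine ⟨listsIn κ A, T, fun f hf l => ?_, fun f _ => (mk_set_le _).trans_lt (mk_listsIn_lt hunc hA),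
    fun f hf hT x hx => eq_zero_of_forall_agree hf (hAF x hx) fun n => ?_⟩
  · simp only [T]
    split_ifs with h
    · exact hf _ h.choose_spec.1
    · rfl
  let l : List (LSpace κ Λ) := (List.range n).map (retractSeq A x)
  have hl : l ∈ listsIn κ A := by
    intro a ha
    obtain ⟨i, -, hi⟩ := List.mem_map.mp ha
    exact (retract_eq_mk hi).1
  have h : ∃ z ∈ F, (List.range l.length).map z = l := ⟨retractSeq A x, hAF x hx, by simp [l]⟩
  have hTl := hT ⟨l, hl⟩
  simp only [T, dif_pos h, ContinuousLinearMap.proj_apply] at hTl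
  obtain ⟨z, hz, hzl, hfz⟩ : ∃ z ∈ F, (List.range l.length).map z = l ∧ f z = 0 :=
    ⟨h.choose, h.choose_spec.1, h.choose_spec.2, hTl⟩
  simp only [l, List.length_map, List.length_range, List.map_inj_left, List.mem_range] at hzl
  exact ⟨z, hz, hzl, hfz⟩

theorem HasSmallFunctionals.hull_union (hreg : κ.IsRegular) (hunc : ℵ₀ < κ)
    {F : Set (ℕ → LSpace κ Λ)} (hF : IsClosed F) {U : List (LSpace κ Λ) → Set Λ}
    (hUF : ∀ A, IsHullClosed U A → ∀ x ∈ F, retractSeq A x ∈ F)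
    [LinearOrder Λ] [WellFoundedLT Λ] {s J : Set Λ} (hJ : IsLowerSet J)
    (h0 : HasSmallFunctionals F (hull U s))
    (h : ∀ γ ∈ J, HasSmallFunctionals F (hull U (insert γ (Iio γ ∪ s)))) :
    HasSmallFunctionals F (hull U (J ∪ s)) := by
  have hmem : ∀ S, ∀ x ∈ F, retractSeq (hull U S) x ∈ F := fun S =>
    hUF _ (isHullClosed_hull U S)
  obtain ⟨Γ₀, T₀, hT₀F, hT₀, hT₀'⟩ := h0
  choose Γ T hTF hT hT' using fun γ : J => h γ γ.2
  let B : J → Set Λ := fun γ => hull U (Iio γ.1 ∪ s)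
  let B' : J → Set Λ := fun γ => hull U (insert γ.1 (Iio γ.1 ∪ s))
  let D : J → (((ℕ → LSpace κ Λ) → ℝ) →L[ℝ] ((ℕ → LSpace κ Λ) → ℝ)) := fun γ =>
    ContinuousLinearMap.pi fun x =>
      ContinuousLinearMap.proj (R := ℝ) (φ := fun _ : ℕ → LSpace κ Λ => ℝ) (retractSeq (B' γ) x) -
      ContinuousLinearMap.proj (R := ℝ) (φ := fun _ : ℕ → LSpace κ Λ => ℝ) (retractSeq (B γ) x)
  have hD : ∀ γ f x, D γ f x = f (retractSeq (B' γ) x) - f (retractSeq (B γ) x) := fun _ _ _ => rfl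
  have hDc : ∀ γ f, ContinuousOn f F → ContinuousOn (D γ f) F := fun γ f hf =>
    (hf.comp (continuous_retractSeq _).continuousOn (hmem _)).sub
      (hf.comp (continuous_retractSeq _).continuousOn (hmem _))
  refine ⟨Γ₀ ⊕ Σ γ, Γ γ, Sum.elim T₀ fun i => (T i.1 i.2).comp (D i.1), fun f hf => ?_,
    fun f hf => ?_, fun f hf hzero => ?_⟩
  · rintro (i | ⟨γ, i⟩)
    · exact hT₀F f hf i
    · refine hTF γ (D γ f) (fun x hx => ?_) i
      rw [hD, hf _ (hmem _ x hx), hf _ (hmem _ x hx), sub_zero]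
  · have hjump := mk_setOf_retractSeq_ne_lt hreg hunc hF (B := B) (B' := B')
      (fun γ => hull_mono (subset_insert _ _))
      (fun γ δ hγδ => hull_mono (insert_subset (Or.inl hγδ)
        (union_subset_union_left _ (Iio_subset_Iio (le_of_lt hγδ)))))
      (fun γ => hmem _) (fun γ => hmem _) hf
    set G := {γ | ∃ x ∈ F, f (retractSeq (B' γ) x) ≠ f (retractSeq (B γ) x)}
    have hcover : {γ | Sum.elim T₀ (fun i : Σ γ, Γ γ => (T i.1 i.2).comp (D i.1)) γ f ≠ 0} ⊆
        Sum.inl '' {γ | T₀ γ f ≠ 0} ∪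
          ⋃ γ ∈ G, (fun i => Sum.inr (⟨γ, i⟩ : Σ γ, Γ γ)) '' {i | T γ i (D γ f) ≠ 0} := by
      rintro (i | ⟨γ, i⟩) hi
      · exact Or.inl ⟨i, hi, rfl⟩
      · refine Or.inr (mem_biUnion ?_ ⟨i, hi, rfl⟩)
        by_contra hγ
        refine hi (hTF γ (D γ f) (fun x hx => ?_) i)
        by_contra hne
        exact hγ ⟨x, hx, fun he => hne (by rw [hD, he, sub_self])⟩
    refine (mk_le_mk_of_subset hcover).trans_lt ((mk_union_le _ _).trans_lt
      (add_lt_of_lt hunc.le (mk_image_le.trans_lt (hT₀ f hf)) ?_))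
    exact (card_biUnion_lt_iff_forall_of_isRegular hreg hjump).mpr fun γ _ =>
      mk_image_le.trans_lt (hT γ _ (hDc γ f hf))
  · intro x hx
    have hstep : ∀ γ : J, f (retractSeq (B γ) x) = 0 → f (retractSeq (B' γ) x) = 0 := by
      intro γ hγ
      have := hT' γ (D γ f) (hDc γ f hf) (fun i => hzero (Sum.inr ⟨γ, i⟩)) x hx
      rw [hD, retractSeq_retractSeq_of_superset subset_rfl,
        retractSeq_retractSeq_of_superset (hull_mono (subset_insert _ _)), hγ, sub_zero] at this
      exact this
    have hlim : ∀ J' : Set Λ, IsLowerSet J' → J' ⊆ J →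
        (∀ γ : J, γ.1 ∈ J' → f (retractSeq (B' γ) x) = 0) →
        f (retractSeq (hull U (J' ∪ s)) x) = 0 := by
      intro J' hJ' hJJ' hB'
      refine eq_zero_of_forall_agree hf (hmem _ x hx) fun n => ?_
      have hE : {a | a ∈ hull U (J' ∪ s) ∧ ∃ i < n, x i = mk κ a}.Finite := by
        refine Finite.subset (((finite_lt_nat n).image x).preimage mk_injective.injOn) ?_
        rintro a ⟨-, i, hi, hxi⟩
        exact ⟨i, hi, hxi⟩
      obtain ⟨t, htS, htf, ht⟩ := exists_finite_hull_of_finite hE fun a ha => ha.1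
      have hagree : ∀ C, t ⊆ C → C ⊆ J' ∪ s → ∀ i < n,
          retractSeq (hull U C) x i = retractSeq (hull U (J' ∪ s)) x i := by
        intro C htC hCS i hi
        refine retract_congr fun a ha => ⟨fun h => hull_mono hCS h, fun h => ?_⟩
        exact hull_mono htC (ht ⟨h, i, hi, ha⟩)
      rcases (t ∩ J').eq_empty_or_nonempty with hne | hne
      · refine ⟨_, hmem s x hx, hagree s (fun a ha => ?_) subset_union_right,
          hT₀' f hf (fun i => hzero (Sum.inl i)) x hx⟩
        exact (htS ha).resolve_left fun haJ => hne.subset ⟨ha, haJ⟩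
      · obtain ⟨m, ⟨hmt, hmJ⟩, hm⟩ := (htf.inter_of_left J').exists_maximal hne
        refine ⟨_, hmem _ x hx, hagree _ (fun a ha => ?_) ?_, hB' ⟨m, hJJ' hmJ⟩ hmJ⟩
        · rcases htS ha with haJ | has
          · rcases lt_trichotomy a m with h | rfl | h
            · exact Or.inr (Or.inl h)
            · exact Or.inl rfl
            · exact ((hm ⟨ha, haJ⟩ h.le).not_gt h).elim
          · exact Or.inr (Or.inr has)
        · exact insert_subset (Or.inl hmJ)
            (union_subset_union_left _ fun a ha => hJ' (le_of_lt ha) hmJ)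
    have hall : ∀ γ : Λ, ∀ hγ : γ ∈ J, f (retractSeq (B' ⟨γ, hγ⟩) x) = 0 := by
      intro γ
      induction γ using WellFoundedLT.induction with
      | ind γ ih =>
        intro hγ
        exact hstep _ (hlim _ (isLowerSet_Iio γ) (fun δ hδ => hJ (le_of_lt hδ) hγ)
          fun δ hδ => ih δ hδ δ.2)
    exact hlim J hJ subset_rfl fun γ _ => hall γ γ.2

theorem hasSmallFunctionals_univ (hreg : κ.IsRegular) (hunc : ℵ₀ < κ)
    {F : Set (ℕ → LSpace κ Λ)} (hF : IsClosed F) : HasSmallFunctionals F univ := by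
  obtain ⟨U, hU, hUF⟩ := exists_isHullClosed_retractSeq_mem hunc.le hF
  obtain ⟨_, hwf⟩ := exists_wellFoundedLT Λ
  have hfin : ∀ s : Set Λ, s.Finite → HasSmallFunctionals F (hull U s) := fun s hs =>
    hasSmallFunctionals_of_mk_lt hunc
      (mk_hull_lt hreg hunc hU ((lt_aleph0_iff_set_finite.mpr hs).trans hunc))
      (hUF _ (isHullClosed_hull U s))
  have hIio : ∀ γ : Λ, ∀ s : Set Λ, s.Finite → HasSmallFunctionals F (hull U (Iio γ ∪ s)) := by
    intro γ
    induction γ using WellFoundedLT.induction with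
    | ind γ ih =>
      intro s hs
      refine .hull_union hreg hunc hF hUF (isLowerSet_Iio γ) (hfin s hs) fun δ hδ => ?_
      rw [← union_insert]
      exact ih δ hδ _ (hs.insert δ)
  have := HasSmallFunctionals.hull_union hreg hunc hF hUF isLowerSet_univ (hfin ∅ finite_empty)
    fun δ _ => by
      rw [← union_insert]
      exact hIio δ _ (finite_singleton δ |>.subset (by simp))
  rwa [union_empty, eq_univ_of_univ_subset (subset_hull U univ)] at this

end LSpace

section Approximation

open Set Topology

theorem exists_rat_polynomial_near {K : Type*} [TopologicalSpace K] [CompactSpace K] {Γ : Type*}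
    {f : K → Γ → ℝ} (hf : Continuous f) (hinj : Function.Injective f) (h : C(K, ℝ)) {ε : ℝ}
    (hε : 0 < ε) :
    ∃ (p : MvPolynomial ℕ ℚ) (z : ℕ → Option Γ),
      ∀ k, |MvPolynomial.aeval (fun i => (z i).elim 0 (f k)) p - h k| < ε := by
  let c : Γ → C(K, ℝ) := fun γ => ⟨fun k => f k γ, (continuous_apply γ).comp hf⟩
  let S : Subalgebra ℚ C(K, ℝ) := Algebra.adjoin ℚ (range c)
  have halg : ∀ r : ℝ, algebraMap ℝ C(K, ℝ) r ∈ S.toSubring.topologicalClosure := fun r =>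
    map_mem_closure (continuous_algebraMap ℝ C(K, ℝ)) (Rat.denseRange_cast (𝕜 := ℝ) r) <| by
      rintro _ ⟨q, rfl⟩
      have := S.algebraMap_mem q
      rwa [IsScalarTower.algebraMap_apply ℚ ℝ C(K, ℝ), eq_ratCast] at this
  let T : Subalgebra ℝ C(K, ℝ) :=
    { S.toSubring.topologicalClosure with algebraMap_mem' := halg }
  have hcS : ∀ γ, c γ ∈ S := fun γ => Algebra.subset_adjoin (mem_range_self γ)
  have hsep : T.SeparatesPoints := by
    intro x y hxy
    obtain ⟨γ, hγ⟩ := Function.ne_iff.mp (hinj.ne hxy)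
    exact ⟨c γ, ⟨c γ, subset_closure (hcS γ), rfl⟩, hγ⟩
  have hT : IsClosed (T : Set C(K, ℝ)) := isClosed_closure
  have hmem : h ∈ closure (S : Set C(K, ℝ)) := by
    have h1 := ContinuousMap.subalgebra_topologicalClosure_eq_top_of_separatesPoints T hsep
    have h2 : h ∈ T.topologicalClosure := h1 ▸ Algebra.mem_top
    have h3 : h ∈ closure (T : Set C(K, ℝ)) := h2
    rwa [hT.closure_eq] at h3
  obtain ⟨s, hs, hsh⟩ := Metric.mem_closure_iff.mp hmem ε hε
  obtain ⟨P, rfl⟩ : ∃ P : MvPolynomial Γ ℚ, MvPolynomial.aeval c P = s := by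
    have : s ∈ Algebra.adjoin ℚ (range c) := hs
    rwa [Algebra.adjoin_range_eq_range_aeval] at this
  obtain ⟨n, v, -, q, rfl⟩ := MvPolynomial.exists_fin_rename P
  refine ⟨MvPolynomial.rename Fin.val q, fun i => if hi : i < n then some (v ⟨i, hi⟩) else none,
    fun k => ?_⟩
  have hk := ContinuousMap.dist_apply_le_dist (f := h)
    (g := MvPolynomial.aeval c (MvPolynomial.rename v q)) k
  rw [dist_comm, Real.dist_eq] at hk
  refine lt_of_le_of_lt (le_of_eq_of_le ?_ hk) hsh
  congr 2
  rw [MvPolynomial.aeval_rename, MvPolynomial.aeval_rename]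
  have := MvPolynomial.comp_aeval_apply (R := ℚ) (c ∘ v) (ContinuousMap.evalAlgHom ℚ ℝ k) q
  rw [ContinuousMap.evalAlgHom_apply] at this
  rw [this]
  congr 1
  ext i
  simp [c]

theorem exists_limit_of_geometric {K X : Type*} (v : ℕ → X → K → ℝ)
    (hv : ∀ n x k, |v (n + 1) x k - v n x k| ≤ (1 / 2) ^ n) :
    ∃ G : X → K → ℝ, ∀ n x k, dist (v n x k) (G x k) ≤ (1 / 2) ^ n * 2 := by
  have hd : ∀ x k n, dist (v n x k) (v (n + 1) x k) ≤ 1 * (1 / 2) ^ n := fun x k n => by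
    rw [dist_comm, Real.dist_eq, one_mul]; exact hv n x k
  have hlim : ∀ x k, ∃ a, Filter.Tendsto (fun n => v n x k) Filter.atTop (𝓝 a) := fun x k =>
    cauchySeq_tendsto_of_complete (cauchySeq_of_le_geometric (1 / 2) 1 (by norm_num) (hd x k))
  choose G hG using hlim
  refine ⟨G, fun n x k => ?_⟩
  have := dist_le_of_le_geometric_of_tendsto (1 / 2) 1 (by norm_num) (hd x k) (hG x k) n
  calc _ ≤ _ := this
    _ = _ := by ring

theorem continuous_of_dist_le_geometric {X : Type*} [TopologicalSpace X] {v : ℕ → X → ℝ}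
    {G : X → ℝ} (hv : ∀ n, Continuous (v n)) (hG : ∀ n x, dist (v n x) (G x) ≤ (1 / 2) ^ n * 2) :
    Continuous G := by
  have : TendstoUniformly v G Filter.atTop := by
    rw [Metric.tendstoUniformly_iff]
    intro ε hε
    have h0 : Filter.Tendsto (fun n : ℕ => ((1 : ℝ) / 2) ^ n * 2) Filter.atTop (𝓝 0) := by
      simpa using (tendsto_pow_atTop_nhds_zero_of_lt_one (r := (1 : ℝ) / 2)
        (by norm_num) (by norm_num)).mul_const 2
    filter_upwards [h0.eventually_lt_const hε] with n hn x
    rw [dist_comm]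
    exact (hG n x).trans_lt hn
  exact this.continuous (Filter.Frequently.of_forall hv)

end Approximation

section Backward

open Cardinal Set Topology

theorem isKappaCorson_of_continuous_surjective {κ : Cardinal.{u}} (hreg : κ.IsRegular)
    (hunc : ℵ₀ < κ) {K : Type u} [TopologicalSpace K] [CompactSpace K] [T2Space K] {Λ : Type u}
    {F : Set (ℕ → LSpace κ Λ)} (hF : IsClosed F) {g : F → Cp K} (hg : Continuous g)
    (hsurj : Function.Surjective g) : IsKappaCorson κ K := by
  classical
  obtain ⟨Γ, T, hT0, hTκ, hTinj⟩ := LSpace.hasSmallFunctionals_univ hreg hunc hF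
  let φ : K → (ℕ → LSpace κ Λ) → ℝ := fun k x => if h : x ∈ F then (g ⟨x, h⟩ : K → ℝ) k else 0
  have hφF : ∀ k (x : F), φ k x = (g x : K → ℝ) k := fun k x => dif_pos x.2
  have hφ : Continuous φ := by
    refine continuous_pi fun x => ?_
    by_cases h : x ∈ F
    · have : Continuous (g ⟨x, h⟩ : K → ℝ) := (g ⟨x, h⟩).2
      simpa only [φ, dif_pos h] using this
    · simpa only [φ, dif_neg h] using continuous_const
  have hφc : ∀ k, ContinuousOn (φ k) F := fun k => by
    rw [continuousOn_iff_continuous_domRestrict]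
    have : F.domRestrict (φ k) = fun x => (g x : K → ℝ) k := funext (hφF k)
    rw [this]
    exact (continuous_apply k).comp (continuous_subtype_val.comp hg)
  let Φ : K → Γ → ℝ := fun k γ => T γ (φ k)
  have hΦ : Continuous Φ := continuous_pi fun γ => (T γ).continuous.comp hφ
  refine ⟨‹_›, ‹_›, Γ, Φ, (hΦ.isClosedEmbedding fun k k' hkk => ?_).isEmbedding,
    fun k => hTκ _ (hφc k)⟩
  by_contra hne
  have hker : ∀ x ∈ F, (φ k - φ k') x = 0 := fun x hx => by
    have := hTinj (φ k - φ k') ((hφc k).sub (hφc k')) (fun γ => by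
      rw [map_sub, sub_eq_zero]
      exact congrFun hkk γ) x hx
    rwa [show LSpace.retractSeq univ x = x from funext fun i => LSpace.retract_univ (x i)] at this
  obtain ⟨h, h0, h1, -⟩ := exists_continuous_zero_one_of_isClosed (isClosed_singleton (x := k))
    (isClosed_singleton (x := k')) (disjoint_singleton.mpr hne)
  obtain ⟨x, hx⟩ := hsurj ⟨h, h.continuous⟩
  have := hker x x.2
  rw [Pi.sub_apply, hφF, hφF, hx] at this
  have e0 : h k = 0 := h0 rfl
  have e1 : h k' = 1 := h1 rfl
  have : h k - h k' = 0 := this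
  rw [e0, e1] at this
  norm_num at this

end Backward

section Forward

open Cardinal Set Topology

namespace LSpace

theorem continuous_of_mk_lt {κ : Cardinal.{u}} {Λ : Type u} {Y : Type*} [TopologicalSpace Y]
    {h : LSpace κ Λ → Y} (hh : #{a | h (mk κ a) ≠ h (infty κ Λ)} < κ) : Continuous h := by
  refine ⟨fun O _ => TopologicalSpace.isOpen_generateFrom_of_mem fun hO => ?_⟩
  refine lt_of_le_of_lt (mk_le_mk_of_subset ?_) hh
  intro a ha heq
  have heq : h (mk κ a) = h (infty κ Λ) := heq
  exact ha (show h (mk κ a) ∈ O from heq ▸ hO)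

/-- The alphabet coding points of `Γ` together with rational polynomials in countably many
variables. -/
abbrev Code (Γ : Type u) : Type u := Γ ⊕ ULift.{u} (MvPolynomial ℕ ℚ)

variable {κ : Cardinal.{u}} {Γ : Type u}

/-- The real number coded by a letter, relative to `y : Γ → ℝ`. -/
def coord (y : Γ → ℝ) : LSpace κ (Code Γ) → ℝ
  | some (.inl γ) => y γ
  | _ => 0

/-- The polynomial coded by a letter. -/
noncomputable def poly : LSpace κ (Code Γ) → MvPolynomial ℕ ℚ
  | some (.inr p) => p.down
  | _ => 0

theorem continuous_coord {y : Γ → ℝ} (hy : #{γ | y γ ≠ 0} < κ) :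
    Continuous (coord y : LSpace κ (Code Γ) → ℝ) := by
  refine continuous_of_mk_lt (lt_of_le_of_lt ?_ hy)
  have hsub : {a : Code Γ | coord y (mk κ a) ≠ coord y (infty κ (Code Γ))} ⊆
      Sum.inl '' {γ | y γ ≠ 0} := by
    rintro (γ | p) ha
    · exact ⟨γ, ha, rfl⟩
    · exact absurd rfl ha
  exact (mk_le_mk_of_subset hsub).trans mk_image_le

theorem continuous_poly (hunc : ℵ₀ < κ) :
    Continuous[_, ⊥] (poly : LSpace κ (Code Γ) → MvPolynomial ℕ ℚ) := by
  let _ : TopologicalSpace (MvPolynomial ℕ ℚ) := ⊥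
  refine continuous_of_mk_lt (lt_of_le_of_lt ?_ hunc)
  have hsub : {a : Code Γ | poly (mk κ a) ≠ poly (infty κ (Code Γ))} ⊆ range Sum.inr := by
    rintro (γ | p) ha
    · exact absurd rfl ha
    · exact ⟨p, rfl⟩
  refine (mk_le_mk_of_subset hsub).trans (mk_range_le.trans ?_)
  rw [mk_uLift, lift_le_aleph0]
  exact MvPolynomial.cardinalMk_le_max.trans (by simp)

theorem continuous_coord_left {K : Type*} [TopologicalSpace K] {f : K → Γ → ℝ}
    (hf : Continuous f) (x : LSpace κ (Code Γ)) : Continuous fun k => coord (f k) x := by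
  rcases x with _ | γ | p
  · exact continuous_const
  · exact (continuous_apply γ).comp hf
  · exact continuous_const

/-- The value at `y` of the `n`-th polynomial expression coded by the sequence `x`. -/
noncomputable def val (n : ℕ) (x : ℕ → LSpace κ (Code Γ)) (y : Γ → ℝ) : ℝ :=
  MvPolynomial.aeval (fun i => coord y (x (Nat.pair n (i + 1)))) (poly (x (Nat.pair n 0)))

theorem _root_.MvPolynomial.continuous_aeval_rat (p : MvPolynomial ℕ ℚ) :
    Continuous fun v : ℕ → ℝ => MvPolynomial.aeval v p := by
  simp only [MvPolynomial.aeval_def, MvPolynomial.eval₂_eq_eval_map]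
  exact MvPolynomial.continuous_eval _

theorem continuous_val (hunc : ℵ₀ < κ) (n : ℕ) {y : Γ → ℝ} (hy : #{γ | y γ ≠ 0} < κ) :
    Continuous fun x : ℕ → LSpace κ (Code Γ) => val n x y := by
  let _ : TopologicalSpace (MvPolynomial ℕ ℚ) := ⊥
  have : DiscreteTopology (MvPolynomial ℕ ℚ) := ⟨rfl⟩
  have h1 : Continuous fun q : MvPolynomial ℕ ℚ × (ℕ → ℝ) => MvPolynomial.aeval q.2 q.1 :=
    continuous_prod_of_discrete_left.mpr MvPolynomial.continuous_aeval_rat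
  have h2 : Continuous fun x : ℕ → LSpace κ (Code Γ) => poly (x (Nat.pair n 0)) :=
    (continuous_poly hunc).comp (continuous_apply _)
  have h3 : Continuous fun (x : ℕ → LSpace κ (Code Γ)) i => coord y (x (Nat.pair n (i + 1))) :=
    continuous_pi fun i => (continuous_coord hy).comp (continuous_apply _)
  have h4 := Continuous.comp h1 (Continuous.prodMk h2 h3)
  simpa only [val, Function.comp_def] using h4

theorem continuous_val_left {K : Type*} [TopologicalSpace K] {f : K → Γ → ℝ}
    (hf : Continuous f) (n : ℕ) (x : ℕ → LSpace κ (Code Γ)) :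
    Continuous fun k => val n x (f k) :=
  (MvPolynomial.continuous_aeval_rat _).comp
    (continuous_pi fun _ => continuous_coord_left hf _)

/-- The sequence coding the polynomials `p n` in the variables `z n`. -/
noncomputable def encode (κ : Cardinal.{u}) (p : ℕ → MvPolynomial ℕ ℚ) (z : ℕ → ℕ → Option Γ) (m : ℕ) :
    LSpace κ (Code Γ) :=
  match m.unpair with
  | (n, 0) => mk κ (.inr ⟨p n⟩)
  | (n, i + 1) => (z n i).elim (infty κ _) fun γ => mk κ (.inl γ)

theorem val_encode (p : ℕ → MvPolynomial ℕ ℚ) (z : ℕ → ℕ → Option Γ) (n : ℕ) (y : Γ → ℝ) :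
    val n (encode κ p z) y = MvPolynomial.aeval (fun i => (z n i).elim 0 y) (p n) := by
  have h1 : poly (encode κ p z (Nat.pair n 0)) = p n := by
    simp only [encode, Nat.unpair_pair]
    rfl
  have h2 : ∀ i, coord y (encode κ p z (Nat.pair n (i + 1))) = (z n i).elim 0 y := fun i => by
    simp only [encode, Nat.unpair_pair]
    cases z n i <;> rfl
  simp only [val, h1, h2]

end LSpace

open LSpace in
theorem IsKappaCorson.exists_continuous_surjective {κ : Cardinal.{u}} (hunc : ℵ₀ < κ) {K : Type u}
    [TopologicalSpace K] (hK : IsKappaCorson κ K) :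
    ∃ (Λ : Type u) (F : Set (ℕ → LSpace κ Λ)), IsClosed F ∧
      ∃ g : F → Cp K, Continuous g ∧ Function.Surjective g := by
  obtain ⟨_, _, Γ, f, hf, hκ⟩ := hK
  let F : Set (ℕ → LSpace κ (Code Γ)) :=
    {x | ∀ n k, |val (n + 1) x (f k) - val n x (f k)| ≤ (1 / 2) ^ n}
  have hF : IsClosed F := by
    have : F = ⋂ n, ⋂ k, {x | |val (n + 1) x (f k) - val n x (f k)| ≤ (1 / 2) ^ n} := by
      ext x
      simp [F]
    rw [this]
    exact isClosed_iInter fun n => isClosed_iInter fun k => isClosed_le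
      ((continuous_val hunc _ (hκ k)).sub (continuous_val hunc _ (hκ k))).abs continuous_const
  obtain ⟨G, hG⟩ := exists_limit_of_geometric (fun n (x : F) k => val n x.1 (f k))
    fun n x k => x.2 n k
  have hGk : ∀ x, Continuous (G x) := fun x =>
    continuous_of_dist_le_geometric (fun n => continuous_val_left hf.continuous n x.1)
      fun n k => hG n x k
  have hGx : ∀ k, Continuous fun x => G x k := fun k =>
    continuous_of_dist_le_geometric
      (fun n => (continuous_val hunc n (hκ k)).comp continuous_subtype_val) fun n x => hG n x k
  refine ⟨_, F, hF, fun x => ⟨G x, hGk x⟩, (continuous_pi hGx).subtype_mk _, fun h => ?_⟩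
  choose p z hpz using fun n : ℕ => exists_rat_polynomial_near hf.continuous hf.injective
    ⟨h, h.2⟩ (ε := (1 / 2) ^ (n + 1)) (by positivity)
  have hval : ∀ n k, |val n (encode κ p z) (f k) - (h : K → ℝ) k| < (1 / 2) ^ (n + 1) :=
    fun n k => by
      rw [val_encode]
      exact hpz n k
  have hmem : encode κ p z ∈ F := fun n k => by
    have h1 := abs_lt.mp (hval n k)
    have h2 := abs_lt.mp (hval (n + 1) k)
    have h3 : (0 : ℝ) < (1 / 2) ^ n := by positivity
    simp only [pow_succ] at h1 h2
    rw [abs_le]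
    constructor <;> linarith
  refine ⟨⟨_, hmem⟩, Subtype.ext (funext fun k => ?_)⟩
  refine eq_of_forall_dist_le fun ε hε => ?_
  obtain ⟨n, hn⟩ := exists_pow_lt_of_lt_one (show (0 : ℝ) < ε / 3 by positivity)
    (show (1 / 2 : ℝ) < 1 by norm_num)
  have h1 := hG n ⟨_, hmem⟩ k
  have h2 := hval n k
  rw [← Real.dist_eq, pow_succ] at h2
  have h3 := dist_triangle_left (G ⟨_, hmem⟩ k) ((h : K → ℝ) k) (val n (encode κ p z) (f k))
  have h4 : (0 : ℝ) < (1 / 2) ^ n := by positivity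
  refine h3.trans ?_
  linarith

end Forward

/-- Let `κ` be a regular uncountable cardinal and `K` a compact Hausdorff space. Then
`K` is `κ`-Corson compact if and only if `C_p(K)` is a continuous image of a closed
subspace of `L_κ(λ)^ω` for some cardinal `λ` (realized by a type `Λ`). -/
theorem stmt17 (κ : Cardinal.{u}) (hreg : κ.IsRegular) (hunc : Cardinal.aleph0 < κ)
    (K : Type u) [TopologicalSpace K] [CompactSpace K] [T2Space K] :
    IsKappaCorson κ K ↔
      ∃ (Λ : Type u) (F : Set (ℕ → LSpace κ Λ)), IsClosed F ∧
        ∃ g : ↥F → Cp K, Continuous g ∧ Function.Surjective g :=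
  ⟨fun h => h.exists_continuous_surjective hunc, fun ⟨_, _, hF, _, hg, hsurj⟩ =>
    isKappaCorson_of_continuous_surjective hreg hunc hF hg hsurj⟩
end

section
/- Let K and L be compact Hausdorff spaces. Assume there exists a continuous linear map φ : C_p(K) → C_p(L) such that φ(C_p(K)) is dense in C_p(L). If K is ω-Corson compact, then L is ω-Corson compact as well. -/
universe u

/-- The linear functional on functions given by a finitely supported signed measure. -/
noncomputable def finsuppPairing {K : Type*} (c : K →₀ ℝ) : (K → ℝ) →ₗ[ℝ] ℝ :=
  c.sum fun x a => a • LinearMap.proj x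

theorem finsuppPairing_eq_sum {K : Type*} (c : K →₀ ℝ) {S : Finset K} (hS : c.support ⊆ S)
    (g : K → ℝ) : finsuppPairing c g = ∑ x ∈ S, c x * g x := by
  rw [finsuppPairing, Finsupp.sum_of_support_subset _ hS _ (by simp)]
  simp

/-- The product of the members of the family `p` listed by the word `w`. -/
def wordProd {K I : Type*} (p : I → K → ℝ) {d : ℕ} (w : Fin d → I) (x : K) : ℝ :=
  ∏ j, p (w j) x

theorem continuous_wordProd {K I : Type*} [TopologicalSpace K] {p : I → K → ℝ}
    (hp : ∀ i, Continuous (p i)) {d : ℕ} (w : Fin d → I) : Continuous (wordProd p w) :=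
  continuous_finsetProd _ fun j _ => hp (w j)

theorem wordProd_mul_mem_span {K I : Type*} (p : I → K → ℝ) {d : ℕ} {g : K → ℝ}
    (hg : g ∈ Submodule.span ℝ (Set.range fun w : Fin d → I => wordProd p w)) (i : I) :
    p i * g ∈ Submodule.span ℝ (Set.range fun w : Fin (d + 1) → I => wordProd p w) := by
  induction hg using Submodule.span_induction with
  | mem g hg =>
    obtain ⟨w, rfl⟩ := hg
    refine Submodule.subset_span ⟨Fin.cons i w, ?_⟩
    funext x
    simp [wordProd, Fin.prod_univ_succ]
  | zero => simp
  | add g h _ _ hg hh => rw [mul_add]; exact add_mem hg hh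
  | smul a g _ hg => rw [mul_smul_comm]; exact Submodule.smul_mem _ a hg

/-- Interpolation by linear combinations of words of a fixed length. -/
theorem exists_mem_span_wordProd {K I : Type*} {p : I → K → ℝ} {i₀ : I} (h₀ : ∀ x, p i₀ x = 1)
    (hsep : ∀ x y, x ≠ y → ∃ i, p i x ≠ p i y) (x : K) (d : ℕ) (T : Finset K)
    (hT : T.card ≤ d) (hx : x ∉ T) :
    ∃ g ∈ Submodule.span ℝ (Set.range fun w : Fin d → I => wordProd p w),
      g x ≠ 0 ∧ ∀ y ∈ T, g y = 0 := by
  classical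
  induction d generalizing T with
  | zero =>
    obtain rfl : T = ∅ := by simpa using hT
    exact ⟨_, Submodule.subset_span ⟨Fin.elim0, rfl⟩, by simp [wordProd], by simp⟩
  | succ d ih =>
    rcases T.eq_empty_or_nonempty with rfl | ⟨y, hy⟩
    · obtain ⟨g, hg, hgx, -⟩ := ih ∅ (by simp) (by simp)
      exact ⟨_, wordProd_mul_mem_span p hg i₀, by simpa [h₀] using hgx, by simp⟩
    · obtain ⟨g, hg, hgx, hgT⟩ := ih (T.erase y) (by rw [Finset.card_erase_of_mem hy]; omega)
        (fun h => hx (Finset.mem_of_mem_erase h))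
      obtain ⟨i, hi⟩ := hsep x y (by rintro rfl; exact hx hy)
      refine ⟨p i * g - p i y • (p i₀ * g), sub_mem (wordProd_mul_mem_span p hg i)
        (Submodule.smul_mem _ _ (wordProd_mul_mem_span p hg i₀)), ?_, fun z hz => ?_⟩
      · have : (p i x - p i y) * g x ≠ 0 := mul_ne_zero (sub_ne_zero.2 hi) hgx
        simpa [h₀, sub_mul] using this
      · by_cases hzy : z = y
        · subst hzy; simp [h₀]
        · simp [hgT z (Finset.mem_erase.2 ⟨hzy, hz⟩)]

/-- The matrix of moments of a finitely supported signed measure. -/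
noncomputable def momentMatrix {K : Type*} {n : ℕ} (c : K →₀ ℝ) (q : Fin n → K → ℝ) :
    Matrix (Fin n) (Fin n) ℝ :=
  Matrix.of fun i j => finsuppPairing c (q i * q j)

theorem le_card_support_of_det_momentMatrix_ne_zero {K : Type*} {n : ℕ} {c : K →₀ ℝ}
    {q : Fin n → K → ℝ} (h : (momentMatrix c q).det ≠ 0) : n ≤ c.support.card := by
  have hmul : momentMatrix c q = (Matrix.of fun i (x : c.support) => c x * q i x) *
      (Matrix.of fun (x : c.support) j => q j x) := by
    ext i j
    simp only [momentMatrix, Matrix.of_apply, Matrix.mul_apply]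
    rw [finsuppPairing_eq_sum c subset_rfl,
      ← Finset.sum_coe_sort c.support (fun x => c x * (q i * q j) x)]
    exact Finset.sum_congr rfl fun x _ => by simp [mul_assoc]
  have hrank := Matrix.rank_of_isUnit _ ((Matrix.isUnit_iff_isUnit_det _).2 h.isUnit)
  rw [Fintype.card_fin, hmul] at hrank
  calc n = _ := hrank.symm
    _ ≤ _ := Matrix.rank_mul_le_left _ _
    _ ≤ _ := Matrix.rank_le_card_width _
    _ = _ := Fintype.card_coe _

theorem exists_ne_zero_of_det_momentMatrix_ne_zero {K : Type*} {n : ℕ} {c : K →₀ ℝ}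
    {q : Fin n → K → ℝ} (h : (momentMatrix c q).det ≠ 0) (i : Fin n) :
    ∃ x ∈ c.support, q i x ≠ 0 := by
  by_contra! hq
  refine h (Matrix.det_eq_zero_of_row_eq_zero i fun j => ?_)
  rw [momentMatrix, Matrix.of_apply, finsuppPairing_eq_sum c subset_rfl]
  exact Finset.sum_eq_zero fun x hx => by simp [hq x hx]

/-- A spanning family of vectors in `ℝⁿ` contains `n` vectors with non-zero determinant. -/
theorem exists_det_ne_zero_of_span_eq_top {W : Type*} {n : ℕ} (v : W → Fin n → ℝ)
    (hv : Submodule.span ℝ (Set.range v) = ⊤) :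
    ∃ α : Fin n → W, (Matrix.of fun i => v (α i)).det ≠ 0 := by
  obtain ⟨f, hf, -, hind⟩ := Submodule.exists_fun_fin_finrank_span_eq ℝ (Set.range v)
  have hn : n = Module.finrank ℝ (Submodule.span ℝ (Set.range v)) := by
    rw [hv, finrank_top, Module.finrank_fin_fun]
  choose α hα using hf
  refine ⟨fun i => α (Fin.cast hn i), IsUnit.ne_zero ?_⟩
  rw [← Matrix.isUnit_iff_isUnit_det, ← Matrix.linearIndependent_rows_iff_isUnit]
  have := hind.comp (Fin.cast hn) (Fin.cast_injective hn)
  have heq : (Matrix.of fun i => v (α (Fin.cast hn i))).row = f ∘ Fin.cast hn :=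
    funext fun i => hα _
  rw [heq]
  exact this

theorem exists_det_momentMatrix_ne_zero {K I : Type*} {p : I → K → ℝ} {i₀ : I}
    (h₀ : ∀ x, p i₀ x = 1) (hsep : ∀ x y, x ≠ y → ∃ i, p i x ≠ p i y) (c : K →₀ ℝ) {n : ℕ}
    (hn : c.support.card = n) :
    ∃ α : Fin n → Fin n → I, (momentMatrix c fun i => wordProd p (α i)).det ≠ 0 := by
  classical
  let e : Fin n ≃ c.support := (Finset.equivFinOfCardEq hn).symm
  let r : (K → ℝ) →ₗ[ℝ] (Fin n → ℝ) := LinearMap.funLeft ℝ ℝ fun j => (e j : K)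
  obtain ⟨α, hα⟩ := exists_det_ne_zero_of_span_eq_top
    (fun w : Fin n → I => r (wordProd p w)) (by
      have hrange : Set.range (fun w : Fin n → I => r (wordProd p w)) =
          r '' Set.range (fun w : Fin n → I => wordProd p w) := by
        rw [← Set.range_comp]; rfl
      rw [hrange, ← Submodule.map_span, eq_top_iff, ← (Pi.basisFun ℝ (Fin n)).span_eq,
        Submodule.span_le]
      rintro _ ⟨j, rfl⟩
      obtain ⟨g, hg, hgx, hgT⟩ := exists_mem_span_wordProd h₀ hsep (e j) n
        (c.support.erase (e j)) ((Finset.card_erase_le).trans hn.le) (by simp)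
      refine ⟨(g (e j))⁻¹ • g, Submodule.smul_mem _ _ hg, ?_⟩
      funext k
      by_cases hk : k = j
      · subst hk; simp [r, LinearMap.funLeft_apply, hgx]
      · have : g (e k) = 0 := hgT _ (Finset.mem_erase.2
          ⟨fun h => hk (e.injective (Subtype.ext h)), (e k).2⟩)
        simp [r, LinearMap.funLeft_apply, this, hk])
  refine ⟨α, ?_⟩
  have hmul : momentMatrix c (fun i => wordProd p (α i)) =
      (Matrix.of fun i => r (wordProd p (α i))) * Matrix.diagonal (fun j => c (e j)) *
        (Matrix.of fun i => r (wordProd p (α i))).transpose := by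
    ext i j
    simp only [momentMatrix, Matrix.of_apply, Matrix.mul_apply (M := _ * _), Matrix.mul_diagonal,
      Matrix.transpose_apply]
    rw [finsuppPairing_eq_sum c subset_rfl, ← Finset.sum_coe_sort c.support
      (fun x => c x * (wordProd p (α i) * wordProd p (α j)) x), ← e.sum_comp]
    refine Finset.sum_congr rfl fun k _ => ?_
    simp only [r, LinearMap.funLeft_apply, Pi.mul_apply]
    ring
  rw [hmul, Matrix.det_mul, Matrix.det_mul, Matrix.det_transpose, Matrix.det_diagonal]
  exact mul_ne_zero (mul_ne_zero hα (Finset.prod_ne_zero_iff.2 fun j _ =>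
    Finsupp.mem_support_iff.1 (e j).2)) hα

/-- Moments along words of length `d` determine measures supported on at most `d` points. -/
theorem eq_of_finsuppPairing_wordProd_eq {K I : Type*} {p : I → K → ℝ} {i₀ : I}
    (h₀ : ∀ x, p i₀ x = 1) (hsep : ∀ x y, x ≠ y → ∃ i, p i x ≠ p i y) {c c' : K →₀ ℝ} {d : ℕ}
    (hd : c.support.card + c'.support.card ≤ d)
    (h : ∀ w : Fin d → I, finsuppPairing c (wordProd p w) = finsuppPairing c' (wordProd p w)) :
    c = c' := by
  classical
  ext x
  let S := insert x (c.support ∪ c'.support)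
  have hS : (S.erase x).card ≤ d := by
    refine le_trans (Finset.card_le_card (t := c.support ∪ c'.support) ?_)
      ((Finset.card_union_le _ _).trans hd)
    exact Finset.erase_insert_subset _ _
  obtain ⟨g, hg, hgx, hgT⟩ := exists_mem_span_wordProd h₀ hsep x d (S.erase x) hS (by simp)
  have heq : finsuppPairing c g = finsuppPairing c' g :=
    LinearMap.eqOn_span (f := finsuppPairing c) (g := finsuppPairing c')
      (by rintro _ ⟨w, rfl⟩; exact h w) hg
  have hval : ∀ b : K →₀ ℝ, b.support ⊆ S → finsuppPairing b g = b x * g x := fun b hb => by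
    rw [finsuppPairing_eq_sum b hb, Finset.sum_eq_single_of_mem x (by simp [S])]
    intro y hy hyx
    rw [hgT y (Finset.mem_erase.2 ⟨hyx, hy⟩), mul_zero]
  rw [hval c (by intro y; simp +contextual [S]), hval c' (by intro y; simp +contextual [S])] at heq
  exact mul_right_cancel₀ hgx heq

/-- Continuous linear functionals on `C_p(K)` are finitely supported signed measures. -/
theorem exists_finsuppPairing_eq {K : Type*} [TopologicalSpace K] (Λ : Cp K →ₗ[ℝ] ℝ)
    (hΛ : Continuous Λ) : ∃ c : K →₀ ℝ, ∀ f : Cp K, Λ f = finsuppPairing c f := by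
  have hopen : IsOpen (Λ ⁻¹' Metric.ball 0 1) := Metric.isOpen_ball.preimage hΛ
  obtain ⟨U, hU, hUeq⟩ := isOpen_induced_iff.1 hopen
  have h0 : (0 : K → ℝ) ∈ U := by
    have : (0 : Cp K) ∈ Subtype.val ⁻¹' U := by rw [hUeq]; simp
    exact this
  obtain ⟨S, u, hu, hSU⟩ := isOpen_pi_iff.1 hU 0 h0
  have hker : ⨅ x : S, LinearMap.ker ((LinearMap.proj (x : K) : (K → ℝ) →ₗ[ℝ] ℝ) ∘ₗ
      (cpSubmodule K).subtype) ≤ LinearMap.ker Λ := by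
    intro f hf
    simp only [Submodule.mem_iInf, LinearMap.mem_ker, LinearMap.comp_apply] at hf
    have hbound : ∀ t : ℝ, |t * Λ f| < 1 := fun t => by
      have : t • f ∈ Subtype.val ⁻¹' U := hSU fun x hx => by
        have hfx : (f : K → ℝ) x = 0 := hf ⟨x, hx⟩
        simpa [hfx] using (hu x hx).2
      rw [hUeq] at this
      simpa using this
    by_contra hne
    have := hbound (Λ f)⁻¹
    rw [inv_mul_cancel₀ hne] at this
    simp at this
  have hmem := mem_span_of_iInf_ker_le_ker hker
  obtain ⟨a, ha⟩ := (Submodule.mem_span_range_iff_exists_fun ℝ).1 hmem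
  classical
  refine ⟨∑ x : S, Finsupp.single (x : K) (a x), fun f => ?_⟩
  have hsub : (∑ x : S, Finsupp.single (x : K) (a x)).support ⊆ S := by
    refine Finsupp.support_finsetSum.trans fun y hy => ?_
    obtain ⟨x, -, hx⟩ := Finset.mem_biUnion.1 hy
    rw [Finset.mem_singleton.1 (Finsupp.support_single_subset hx)]
    exact x.2
  rw [finsuppPairing_eq_sum _ hsub, ← Finset.sum_coe_sort S, ← ha, LinearMap.sum_apply]
  refine Finset.sum_congr rfl fun x _ => ?_
  have : (∑ x : S, Finsupp.single (x : K) (a x)) (x : K) = a x := by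
    rw [Finsupp.finsetSum_apply, Finset.sum_eq_single x]
    · simp
    · intro y _ hy
      exact Finsupp.single_eq_of_ne (fun h => hy (Subtype.ext h.symm))
    · simp
  rw [this]
  simp

theorem exists_Cp_ne {L : Type*} [TopologicalSpace L] [CompactSpace L] [T2Space L] {l l' : L}
    (h : l ≠ l') : ∃ u : Cp L, (u : L → ℝ) l ≠ (u : L → ℝ) l' := by
  obtain ⟨u, h0, h1, -⟩ := exists_continuous_zero_one_of_isClosed (isClosed_singleton (x := l))
    (isClosed_singleton (x := l')) (by simpa using h)
  refine ⟨⟨u, u.continuous⟩, ?_⟩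
  simp [h0 (Set.mem_singleton l), h1 (Set.mem_singleton l')]

/-- A compact space mapping injectively and weak-* continuously into the finitely supported
measures on `K` is ω-Corson, if `K` carries a suitable point-finite separating family. -/
theorem isKappaCorson_of_finsupp {K L I : Type u} [TopologicalSpace K] [TopologicalSpace L]
    [CompactSpace L] [T2Space L] {p : I → K → ℝ} (hp : ∀ i, Continuous (p i)) {i₀ : I}
    (h₀ : ∀ x, p i₀ x = 1) (hsep : ∀ x y, x ≠ y → ∃ i, p i x ≠ p i y)
    (hfin : ∀ x, {i | p i x ≠ 0}.Finite) (c : L → K →₀ ℝ) (hc : Function.Injective c)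
    (hcont : ∀ g : K → ℝ, Continuous g → Continuous fun l => finsuppPairing (c l) g) :
    IsKappaCorson Cardinal.aleph0 L := by
  let J : Type u := Σ n : ℕ, (Fin n → Fin n → I) × Option (Fin (2 * n) → I)
  let D : ∀ n : ℕ, (Fin n → Fin n → I) → L → ℝ := fun n α l =>
    (momentMatrix (c l) fun i => wordProd p (α i)).det
  let m : ∀ n : ℕ, Option (Fin (2 * n) → I) → L → ℝ := fun n o l =>
    o.elim 1 fun w => finsuppPairing (c l) (wordProd p w)
  let F : L → J → ℝ := fun l j => D j.1 j.2.1 l * m j.1 j.2.2 l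
  have hDcont : ∀ n α, Continuous (D n α) := fun n α =>
    Continuous.matrix_det (continuous_matrix fun i j =>
      hcont _ ((continuous_wordProd hp _).mul (continuous_wordProd hp _)))
  have hmcont : ∀ n o, Continuous (m n o) := by
    rintro n (_ | w)
    · exact continuous_const
    · exact hcont _ (continuous_wordProd hp _)
  have hFcont : Continuous F := continuous_pi fun j => (hDcont _ _).mul (hmcont _ _)
  have hle : ∀ l l', F l = F l' → (c l').support.card ≤ (c l).support.card → l = l' := by
    intro l l' hF hcard
    obtain ⟨α, hα⟩ := exists_det_momentMatrix_ne_zero h₀ hsep (c l) rfl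
    have hD : D _ α l = D _ α l' := by simpa [F, m] using congrFun hF ⟨_, α, none⟩
    have hα' : D _ α l' ≠ 0 := hD ▸ hα
    have := le_card_support_of_det_momentMatrix_ne_zero hα'
    refine hc (eq_of_finsuppPairing_wordProd_eq h₀ hsep
      (d := 2 * (c l).support.card) (by omega) fun w => ?_)
    have hw : D _ α l * finsuppPairing (c l) (wordProd p w) =
        D _ α l' * finsuppPairing (c l') (wordProd p w) := congrFun hF ⟨_, α, some w⟩
    rw [hD] at hw
    exact mul_left_cancel₀ hα' hw
  have hFinj : Function.Injective F := fun l l' hF =>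
    (le_total (c l').support.card (c l).support.card).elim (hle l l' hF)
      fun h => (hle l' l hF.symm h).symm
  refine ⟨inferInstance, inferInstance, J, F,
    (hFcont.isClosedEmbedding hFinj).isEmbedding, fun l => ?_⟩
  rw [Cardinal.lt_aleph0_iff_set_finite]
  let A : Set I := ⋃ x ∈ (c l).support, {i | p i x ≠ 0}
  have hA : A.Finite := (c l).support.finite_toSet.biUnion fun x _ => hfin x
  have hword : ∀ {d : ℕ} {w : Fin d → I} {x : K}, x ∈ (c l).support → wordProd p w x ≠ 0 →
      w ∈ {w : Fin d → I | ∀ j, w j ∈ A} := fun hx hw j =>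
    Set.mem_biUnion hx (Finset.prod_ne_zero_iff.1 hw j (Finset.mem_univ j))
  have hwfin : ∀ d : ℕ, {w : Fin d → I | ∀ j, w j ∈ A}.Finite := fun d => Set.Finite.pi' fun _ => hA
  have hbig : (⋃ n ∈ Set.Iic (c l).support.card, Sigma.mk n '' ({α : Fin n → Fin n → I |
      ∀ i, α i ∈ {w : Fin n → I | ∀ j, w j ∈ A}} ×ˢ
        insert none (some '' {w : Fin (2 * n) → I | ∀ j, w j ∈ A})) : Set J).Finite :=
    (Set.finite_Iic _).biUnion fun n _ => Set.Finite.image _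
      ((Set.Finite.pi' fun _ => hwfin n).prod (((hwfin _).image _).insert _))
  refine hbig.subset ?_
  rintro ⟨n, α, o⟩ hj
  obtain ⟨hD, hm⟩ := mul_ne_zero_iff.1 hj
  refine Set.mem_biUnion (x := n) (le_card_support_of_det_momentMatrix_ne_zero hD)
    ⟨(α, o), ⟨fun i => ?_, ?_⟩, rfl⟩
  · obtain ⟨x, hx, hne⟩ := exists_ne_zero_of_det_momentMatrix_ne_zero hD i
    exact hword hx hne
  · rcases o with _ | w
    · exact Set.mem_insert _ _
    · refine Set.mem_insert_of_mem _ ⟨w, ?_, rfl⟩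
      have hw : finsuppPairing (c l) (wordProd p w) ≠ 0 := hm
      rw [finsuppPairing_eq_sum _ subset_rfl] at hw
      obtain ⟨x, hx, hne⟩ := Finset.exists_ne_zero_of_sum_ne_zero hw
      exact hword hx (right_ne_zero_of_mul hne)

/-- Let `K` and `L` be compact Hausdorff spaces and `φ : C_p(K) → C_p(L)` a continuous
linear map with dense image. If `K` is ω-Corson compact, then `L` is ω-Corson compact
as well. -/
theorem stmt19 (K L : Type u)
    [TopologicalSpace K] [CompactSpace K] [T2Space K]
    [TopologicalSpace L] [CompactSpace L] [T2Space L]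
    (hK : IsKappaCorson Cardinal.aleph0 K)
    (φ : Cp K →ₗ[ℝ] Cp L) (hcont : Continuous φ) (hdense : DenseRange φ) :
    IsKappaCorson Cardinal.aleph0 L := by
  obtain ⟨-, -, Γ, f, hf, hfin⟩ := hK
  have heval : ∀ l : L, Continuous fun u : Cp L => (u : L → ℝ) l := fun l =>
    (continuous_apply l).comp continuous_subtype_val
  choose c hc using fun l : L => exists_finsuppPairing_eq
    ((LinearMap.proj l : (L → ℝ) →ₗ[ℝ] ℝ) ∘ₗ (cpSubmodule L).subtype ∘ₗ φ)
    ((heval l).comp hcont)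
  let p : Option Γ → K → ℝ := fun o x => o.elim 1 (f x)
  refine isKappaCorson_of_finsupp (p := p) (i₀ := none) ?_ (fun _ => rfl) ?_ ?_ c ?_ ?_
  · rintro (_ | γ)
    · exact continuous_const
    · exact (continuous_apply γ).comp hf.continuous
  · intro x y hxy
    obtain ⟨γ, hγ⟩ := Function.ne_iff.1 (hf.injective.ne hxy)
    exact ⟨some γ, hγ⟩
  · intro x
    have hx : {γ | f x γ ≠ 0}.Finite := Cardinal.lt_aleph0_iff_set_finite.1 (hfin x)
    refine ((hx.image some).insert none).subset ?_
    rintro (_ | γ) h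
    · exact Set.mem_insert _ _
    · exact Set.mem_insert_of_mem _ ⟨γ, h, rfl⟩
  · intro l l' hll
    by_contra hne
    obtain ⟨u, hu⟩ := exists_Cp_ne hne
    refine hu (hdense.induction_on (p := fun u : Cp L => (u : L → ℝ) l = (u : L → ℝ) l') u
      (isClosed_eq (heval l) (heval l')) fun g => ?_)
    exact (hc l g).trans (hll ▸ (hc l' g).symm)
  · intro g hg
    exact (φ ⟨g, hg⟩).2.congr fun l => hc l ⟨g, hg⟩
end
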